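/- arXiv:2507.18805 — 2 statements merged into one kernel-verified Lean document; each statement's English description precedes it below -/
import Mathlib

section
/- Let E ⊂ ℝⁿ be closed, non-empty, with |E| = 0, and suppose there exist σ, C₀ > 0 such that 𝓛_{Q₀}(t) ≤ (C₀/t^σ) 𝓢_{Q₀}(t) for every cube Q₀ intersecting E and every t ∈ (0,1). Then for every 1 < p < ∞ and every α with 0 < α < min{1/σ, (p−1)/σ}, the weight dist(·,E)^{-α} belongs to A_p. -/
open MeasureTheory Set
open scoped Classical

/-- A half-open axis-parallel cube in `ℝⁿ`. -/
structure Cube (n : ℕ) where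
  a : Fin n → ℝ
  l : ℝ
  l_pos : 0 < l

namespace Cube

/-- The set of points of the cube. -/
def carrier {n : ℕ} (Q : Cube n) : Set (Fin n → ℝ) :=
  {x | ∀ i, Q.a i ≤ x i ∧ x i < Q.a i + Q.l}

/-- The volume (Lebesgue measure) of the cube. -/
def vol {n : ℕ} (Q : Cube n) : ℝ := Q.l ^ n

end Cube

/-- `Q` is a dyadic subcube of `Q₀` of generation `j`. -/
def IsDyadic {n : ℕ} (Q₀ Q : Cube n) (j : ℕ) : Prop :=
  Q.l = Q₀.l / 2 ^ j ∧
    ∃ k : Fin n → ℕ, (∀ i, k i < 2 ^ j) ∧ ∀ i, Q.a i = Q₀.a i + (k i : ℝ) * Q₀.l / 2 ^ j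

/-- The dyadic system of subcubes of `Q₀`. -/
def dyadicFamily {n : ℕ} (Q₀ : Cube n) : Set (Cube n) := {Q | ∃ j, IsDyadic Q₀ Q j}

/-- `P` is the dyadic parent of `Q` inside the dyadic system of `Q₀`. -/
def IsParent {n : ℕ} (Q₀ P Q : Cube n) : Prop :=
  ∃ j : ℕ, IsDyadic Q₀ Q (j + 1) ∧ IsDyadic Q₀ P j ∧ Q.carrier ⊆ P.carrier

/-- The family `D_E(Q₀)` of maximal dyadic subcubes of `Q₀` avoiding `E` whose dyadic
parent meets `E`. -/
def DE {n : ℕ} (E : Set (Fin n → ℝ)) (Q₀ : Cube n) : Set (Cube n) :=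
  {Q | Q ∈ dyadicFamily Q₀ ∧ Q.carrier ∩ E = ∅ ∧
    ∀ P : Cube n, IsParent Q₀ P Q → (P.carrier ∩ E).Nonempty}

/-- `Σ_{Q ∈ D_E(Q₀), l(Q) ≥ L} |Q|`. -/
noncomputable def sumGE {n : ℕ} (E : Set (Fin n → ℝ)) (Q₀ : Cube n) (L : ℝ) : ℝ :=
  ∑' Q : {Q : Cube n // Q ∈ DE E Q₀ ∧ L ≤ Q.l}, (Q : Cube n).vol

/-- `Σ_{Q ∈ D_E(Q₀), l(Q) ≤ L} |Q|`. -/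
noncomputable def sumLE {n : ℕ} (E : Set (Fin n → ℝ)) (Q₀ : Cube n) (L : ℝ) : ℝ :=
  ∑' Q : {Q : Cube n // Q ∈ DE E Q₀ ∧ Q.l ≤ L}, (Q : Cube n).vol

/-- `Σ_{Q ∈ D_E(Q₀), l(Q) < L} |Q|`. -/
noncomputable def sumLT {n : ℕ} (E : Set (Fin n → ℝ)) (Q₀ : Cube n) (L : ℝ) : ℝ :=
  ∑' Q : {Q : Cube n // Q ∈ DE E Q₀ ∧ Q.l < L}, (Q : Cube n).vol

/-- `Σ_{Q ∈ D_E(Q₀), l(Q) > L} |Q|`. -/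
noncomputable def sumGT {n : ℕ} (E : Set (Fin n → ℝ)) (Q₀ : Cube n) (L : ℝ) : ℝ :=
  ∑' Q : {Q : Cube n // Q ∈ DE E Q₀ ∧ L < Q.l}, (Q : Cube n).vol

/-- The set `𝓛(t,Q₀,E)`. -/
def Lset {n : ℕ} (t : ℝ) (Q₀ : Cube n) (E : Set (Fin n → ℝ)) : Set ℝ :=
  {L | 0 ≤ L ∧ t * Q₀.vol ≤ sumGE E Q₀ L}

/-- The set `𝓢(t,Q₀,E)`. -/
def Sset {n : ℕ} (t : ℝ) (Q₀ : Cube n) (E : Set (Fin n → ℝ)) : Set ℝ :=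
  {L | 0 ≤ L ∧ t * Q₀.vol ≤ sumLE E Q₀ L}

/-- `𝓛_{Q₀}(t) = sup 𝓛(t,Q₀,E)` (the max, when attained). -/
noncomputable def Lfun {n : ℕ} (E : Set (Fin n → ℝ)) (Q₀ : Cube n) (t : ℝ) : ℝ :=
  sSup (Lset t Q₀ E)

/-- `𝓢_{Q₀}(t) = inf 𝓢(t,Q₀,E)` (the min, when attained). -/
noncomputable def Sfun {n : ℕ} (E : Set (Fin n → ℝ)) (Q₀ : Cube n) (t : ℝ) : ℝ :=
  sInf (Sset t Q₀ E)

/-- The Muckenhoupt class `A_p` (for `p = 1` the `A₁` condition, for `p > 1` the usual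
`A_p` condition), with cubes as the testing family. -/
def IsAp {n : ℕ} (p : ℝ) (w : (Fin n → ℝ) → ℝ) : Prop :=
  (∀ᵐ x, 0 < w x) ∧ LocallyIntegrable w volume ∧
    ∃ C : ℝ, 0 < C ∧ ∀ Q : Cube n,
      if p = 1 then
        (∫ x in Q.carrier, w x) / Q.vol ≤ C * essInf w (volume.restrict Q.carrier)
      else
        ((∫ x in Q.carrier, w x) / Q.vol) *
          ((∫ x in Q.carrier, w x ^ (-1 / (p - 1))) / Q.vol) ^ (p - 1) ≤ C


/-! ### Layer cake estimate -/

lemma layer_est {X : Type*} [MeasurableSpace X] (μ : Measure X) (f : X → ℝ) (hf : Measurable f)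
    (hf0 : ∀ x, 0 ≤ f x) (A m β γ : ℝ) (hA : 0 < A) (hm : 0 < m) (hγ : 0 < γ) (hγβ : γ < β)
    (hμ : μ univ ≤ ENNReal.ofReal A)
    (h : ∀ t : ℝ, 0 < t → μ {x | t < f x} ≤ ENNReal.ofReal (A * (m / t) ^ β)) :
    ∫⁻ x, ENNReal.ofReal (f x ^ γ) ∂μ ≤
      ENNReal.ofReal (A * m ^ γ * (1 + γ / (β - γ))) := by
  rw [lintegral_rpow_eq_lintegral_meas_lt_mul μ (Filter.Eventually.of_forall hf0)
    hf.aemeasurable hγ]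
  have hsplit : Ioi (0:ℝ) = Ioc 0 m ∪ Ioi m := by
    rw [Ioc_union_Ioi_eq_Ioi hm.le]
  have h1 : ∫⁻ t in Ioc 0 m, μ {a | t < f a} * ENNReal.ofReal (t ^ (γ - 1)) ≤
      ENNReal.ofReal (A * (m ^ γ / γ)) := by
    have hIntg : IntegrableOn (fun t : ℝ => A * t ^ (γ - 1)) (Ioc 0 m) := by
      have := (intervalIntegral.intervalIntegrable_rpow' (a := 0) (b := m)
        (r := γ - 1) (by linarith))
      rw [intervalIntegrable_iff_integrableOn_Ioc_of_le hm.le] at this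
      exact this.const_mul A
    calc _ ≤ ∫⁻ t in Ioc 0 m, ENNReal.ofReal (A * t ^ (γ - 1)) := by
          apply lintegral_mono
          intro t
          change μ {a | t < f a} * ENNReal.ofReal (t ^ (γ - 1)) ≤ ENNReal.ofReal (A * t ^ (γ - 1))
          rw [ENNReal.ofReal_mul hA.le]
          gcongr
          exact (measure_mono (subset_univ _)).trans hμ
      _ = ENNReal.ofReal (∫ t in Ioc 0 m, A * t ^ (γ - 1)) := by
          rw [ofReal_integral_eq_lintegral_ofReal hIntg]
          filter_upwards [ae_restrict_mem measurableSet_Ioc] with t ht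
          have := ht.1
          simp only [Pi.zero_apply]; positivity
      _ = _ := by
          rw [← intervalIntegral.integral_of_le hm.le, intervalIntegral.integral_const_mul,
            integral_rpow (Or.inl (by linarith))]
          simp [hγ.ne']
  have h2 : ∫⁻ t in Ioi m, μ {a | t < f a} * ENNReal.ofReal (t ^ (γ - 1)) ≤
      ENNReal.ofReal (A * m ^ γ / (β - γ)) := by
    have hIntg : IntegrableOn (fun t : ℝ => A * m ^ β * t ^ (γ - 1 - β)) (Ioi m) :=
      (integrableOn_Ioi_rpow_of_lt (by linarith) hm).const_mul _
    calc _ ≤ ∫⁻ t in Ioi m, ENNReal.ofReal (A * m ^ β * t ^ (γ - 1 - β)) := by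
          apply setLIntegral_mono' measurableSet_Ioi
          intro t ht
          have ht0 : 0 < t := hm.trans ht
          calc _ ≤ ENNReal.ofReal (A * (m / t) ^ β) * ENNReal.ofReal (t ^ (γ - 1)) := by
                gcongr
                exact h t ht0
            _ = _ := by
                rw [← ENNReal.ofReal_mul (by positivity)]
                congr 1
                rw [Real.div_rpow hm.le ht0.le, Real.rpow_sub ht0 (γ - 1) β]
                ring
      _ = ENNReal.ofReal (∫ t in Ioi m, A * m ^ β * t ^ (γ - 1 - β)) := by
          rw [ofReal_integral_eq_lintegral_ofReal hIntg]
          filter_upwards [ae_restrict_mem measurableSet_Ioi] with t ht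
          have : 0 < t := hm.trans ht
          simp only [Pi.zero_apply]; positivity
      _ = _ := by
          rw [integral_const_mul, integral_Ioi_rpow_of_lt (by linarith) hm]
          congr 1
          have e : γ - 1 - β + 1 = γ - β := by ring
          rw [e, Real.rpow_sub hm]
          have : γ - β ≠ 0 := by linarith
          have : β - γ ≠ 0 := by linarith
          have : m ^ β ≠ 0 := by positivity
          field_simp
          ring
  rw [hsplit, lintegral_union measurableSet_Ioi (by
    rw [Set.disjoint_left]; intro x hx hx'; exact absurd hx.2 (not_le.2 hx'))]
  have hd : 0 < β - γ := by linarith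
  calc _ ≤ ENNReal.ofReal γ * (ENNReal.ofReal (A * (m ^ γ / γ)) +
        ENNReal.ofReal (A * m ^ γ / (β - γ))) := by gcongr
    _ = _ := by
      rw [← ENNReal.ofReal_add (by positivity) (by positivity), ← ENNReal.ofReal_mul hγ.le]
      congr 1
      field_simp

/-! ### Geometry of dyadic cubes -/

section Geometry
variable {n : ℕ}

lemma Cube.ext' {P Q : Cube n} (ha : P.a = Q.a) (hl : P.l = Q.l) : P = Q := by
  cases P; cases Q; simp_all

lemma Cube.carrier_eq (Q : Cube n) :
    Q.carrier = Set.pi univ (fun i => Ico (Q.a i) (Q.a i + Q.l)) := by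
  ext x; simp [Cube.carrier]

lemma Cube.meas (Q : Cube n) : MeasurableSet Q.carrier := by
  rw [Cube.carrier_eq]
  exact MeasurableSet.univ_pi fun i => measurableSet_Ico

lemma Cube.volume_carrier (Q : Cube n) : volume Q.carrier = ENNReal.ofReal Q.vol := by
  rw [Cube.carrier_eq, Real.volume_pi_Ico]
  simp [Cube.vol, ENNReal.ofReal_pow Q.l_pos.le]

lemma Cube.vol_pos (Q : Cube n) : 0 < Q.vol := pow_pos Q.l_pos n

lemma Cube.dist_lt (Q : Cube n) {x y : Fin n → ℝ} (hx : x ∈ Q.carrier) (hy : y ∈ Q.carrier) :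
    dist x y < Q.l := by
  rw [dist_pi_lt_iff Q.l_pos]
  intro i
  rw [Real.dist_eq, abs_lt]
  have := hx i; have := hy i
  constructor <;> linarith

/-- The dyadic cube with given indices. -/
noncomputable def dcube (Q₀ : Cube n) (j : ℕ) (k : Fin n → ℕ) : Cube n where
  a := fun i => Q₀.a i + (k i : ℝ) * Q₀.l / 2 ^ j
  l := Q₀.l / 2 ^ j
  l_pos := div_pos Q₀.l_pos (by positivity)

lemma dcube_isDyadic (Q₀ : Cube n) (j : ℕ) (k : Fin n → ℕ) (hk : ∀ i, k i < 2 ^ j) :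
    IsDyadic Q₀ (dcube Q₀ j k) j := ⟨rfl, k, hk, fun _ => rfl⟩

lemma IsDyadic.exists_eq {Q₀ Q : Cube n} {j : ℕ} (h : IsDyadic Q₀ Q j) :
    ∃ k : Fin n → ℕ, (∀ i, k i < 2 ^ j) ∧ Q = dcube Q₀ j k := by
  obtain ⟨hl, k, hk, ha⟩ := h
  exact ⟨k, hk, Cube.ext' (funext ha) hl⟩

lemma mem_dcube {Q₀ : Cube n} {j : ℕ} {k : Fin n → ℕ} {x : Fin n → ℝ} :
    x ∈ (dcube Q₀ j k).carrier ↔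
      ∀ i, (k i : ℝ) ≤ (x i - Q₀.a i) / Q₀.l * 2 ^ j ∧
        (x i - Q₀.a i) / Q₀.l * 2 ^ j < (k i : ℝ) + 1 := by
  have hl := Q₀.l_pos
  have h2 : (0:ℝ) < 2 ^ j := by positivity
  simp only [Cube.carrier, dcube, mem_ofPred_eq]
  refine forall_congr' fun i => and_congr ?_ ?_
  · rw [div_mul_eq_mul_div, le_div_iff₀ hl, ← le_sub_iff_add_le', div_le_iff₀ h2]
  · rw [div_mul_eq_mul_div, div_lt_iff₀ hl, add_assoc, ← sub_lt_iff_lt_add', ← add_div,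
      lt_div_iff₀ h2]
    ring_nf

lemma exists_dcube {Q₀ : Cube n} {x : Fin n → ℝ} (hx : x ∈ Q₀.carrier) (j : ℕ) :
    ∃ P, IsDyadic Q₀ P j ∧ x ∈ P.carrier := by
  have hl := Q₀.l_pos
  have h2 : (0:ℝ) < 2 ^ j := by positivity
  have h0 : ∀ i, 0 ≤ (x i - Q₀.a i) / Q₀.l * 2 ^ j := fun i => by
    have := (hx i).1
    have : 0 ≤ x i - Q₀.a i := by linarith
    positivity
  have h1 : ∀ i, (x i - Q₀.a i) / Q₀.l * 2 ^ j < 2 ^ j := fun i => by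
    have := (hx i).2
    have : (x i - Q₀.a i) / Q₀.l < 1 := by rw [div_lt_one hl]; linarith
    nlinarith
  refine ⟨dcube Q₀ j fun i => ⌊(x i - Q₀.a i) / Q₀.l * 2 ^ j⌋₊, dcube_isDyadic _ _ _ ?_, ?_⟩
  · intro i
    rw [Nat.floor_lt (h0 i)]
    exact_mod_cast h1 i
  · rw [mem_dcube]
    exact fun i => ⟨Nat.floor_le (h0 i), Nat.lt_floor_add_one _⟩

lemma dyadic_nested {Q₀ P Q : Cube n} {i j : ℕ} (hij : i ≤ j) (hQ : IsDyadic Q₀ Q i)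
    (hP : IsDyadic Q₀ P j) {x : Fin n → ℝ} (hxQ : x ∈ Q.carrier) (hxP : x ∈ P.carrier) :
    P.carrier ⊆ Q.carrier := by
  obtain ⟨k, hk, rfl⟩ := hQ.exists_eq
  obtain ⟨k', hk', rfl⟩ := hP.exists_eq
  obtain ⟨e, rfl⟩ := Nat.exists_eq_add_of_le hij
  intro y hy
  rw [mem_dcube] at *
  intro c
  have h2 : (0:ℝ) < 2 ^ e := by positivity
  obtain ⟨a1, a2⟩ := hxQ c
  obtain ⟨b1, b2⟩ := hxP c
  obtain ⟨c1, c2⟩ := hy c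
  rw [pow_add, ← mul_assoc] at b1 b2 c1 c2
  set u := (x c - Q₀.a c) / Q₀.l * 2 ^ i
  set v := (y c - Q₀.a c) / Q₀.l * 2 ^ i
  have e1 : k c * 2 ^ e ≤ k' c := by
    have : ((k c * 2 ^ e : ℕ) : ℝ) < ((k' c + 1 : ℕ) : ℝ) := by
      push_cast; nlinarith
    have := Nat.cast_lt.1 this
    omega
  have e2 : k' c + 1 ≤ (k c + 1) * 2 ^ e := by
    have : ((k' c : ℕ) : ℝ) < (((k c + 1) * 2 ^ e : ℕ) : ℝ) := by
      push_cast; nlinarith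
    exact Nat.cast_lt.1 this
  have e1' : (k c : ℝ) * 2 ^ e ≤ k' c := by exact_mod_cast e1
  have e2' : (k' c : ℝ) + 1 ≤ (k c + 1) * 2 ^ e := by exact_mod_cast e2
  constructor
  · exact le_of_mul_le_mul_right (e1'.trans c1) h2
  · exact lt_of_mul_lt_mul_right (c2.trans_le e2') h2.le

lemma dyadic_unique {Q₀ P Q : Cube n} {j : ℕ} (hQ : IsDyadic Q₀ Q j)
    (hP : IsDyadic Q₀ P j) {x : Fin n → ℝ} (hxQ : x ∈ Q.carrier) (hxP : x ∈ P.carrier) :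
    P = Q := by
  obtain ⟨k, hk, rfl⟩ := hQ.exists_eq
  obtain ⟨k', hk', rfl⟩ := hP.exists_eq
  rw [mem_dcube] at *
  congr 1
  funext c
  obtain ⟨a1, a2⟩ := hxQ c
  obtain ⟨b1, b2⟩ := hxP c
  have h1 : ((k c : ℕ) : ℝ) < ((k' c + 1 : ℕ) : ℝ) := by push_cast; linarith
  have h2 : ((k' c : ℕ) : ℝ) < ((k c + 1 : ℕ) : ℝ) := by push_cast; linarith
  have := Nat.cast_lt.1 h1
  have := Nat.cast_lt.1 h2
  omega

lemma dyadic_gen {Q₀ Q : Cube n} {i j : ℕ} (h : IsDyadic Q₀ Q i) (h' : IsDyadic Q₀ Q j) :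
    i = j := by
  have e := h.1.symm.trans h'.1
  have hl := Q₀.l_pos
  rw [div_eq_div_iff (by positivity) (by positivity)] at e
  have e' := mul_left_cancel₀ hl.ne' e
  exact (Nat.pow_right_injective (le_refl 2) (by exact_mod_cast e')).symm

lemma dyadic_zero (Q₀ : Cube n) {Q : Cube n} (h : IsDyadic Q₀ Q 0) : Q = Q₀ := by
  obtain ⟨hl, k, hk, ha⟩ := h
  refine Cube.ext' ?_ (by simpa using hl)
  funext i
  have := hk i
  have h0 : k i = 0 := by simpa using this
  rw [ha i, h0]; simp

lemma dyadic_self (Q₀ : Cube n) : IsDyadic Q₀ Q₀ 0 :=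
  ⟨by simp, fun _ => 0, by simp, by simp⟩

lemma dyadic_subset {Q₀ Q : Cube n} {j : ℕ} (h : IsDyadic Q₀ Q j) : Q.carrier ⊆ Q₀.carrier := by
  intro x hx
  obtain ⟨k, hk, rfl⟩ := h.exists_eq
  rw [mem_dcube] at hx
  have hl := Q₀.l_pos
  intro i
  obtain ⟨h1, h2⟩ := hx i
  have h3 : ((k i : ℕ) : ℝ) + 1 ≤ 2 ^ j := by exact_mod_cast hk i
  have h4 : (0:ℝ) < 2 ^ j := by positivity
  have h5 : 0 ≤ (x i - Q₀.a i) / Q₀.l := by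
    by_contra hc
    push Not at hc
    have : (0:ℝ) ≤ k i := Nat.cast_nonneg _
    nlinarith
  have h6 : (x i - Q₀.a i) / Q₀.l < 1 := by
    by_contra hc
    push Not at hc
    nlinarith
  rw [div_lt_one hl] at h6
  have h7 : 0 ≤ x i - Q₀.a i := by
    have := mul_nonneg h5 hl.le
    rwa [div_mul_cancel₀ _ hl.ne'] at this
  constructor <;> linarith

/-- Every dyadic cube of positive generation has a parent. -/
lemma exists_parent {Q₀ Q : Cube n} {j : ℕ} (h : IsDyadic Q₀ Q (j + 1)) {x : Fin n → ℝ}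
    (hx : x ∈ Q.carrier) :
    ∃ P, IsDyadic Q₀ P j ∧ Q.carrier ⊆ P.carrier ∧ IsParent Q₀ P Q := by
  obtain ⟨P, hP, hxP⟩ := exists_dcube (dyadic_subset h hx) j
  have hs := dyadic_nested (Nat.le_succ j) hP h hxP hx
  exact ⟨P, hP, hs, j, h, hP, hs⟩

variable {E : Set (Fin n → ℝ)} {Q₀ : Cube n}

lemma DE_eq_of_mem_aux {P Q : Cube n} {i j : ℕ} (hij : i ≤ j) (hQ : Q ∈ DE E Q₀)
    (hP : P ∈ DE E Q₀) (hQi : IsDyadic Q₀ Q i) (hPj : IsDyadic Q₀ P j)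
    {x : Fin n → ℝ} (hxQ : x ∈ Q.carrier) (hxP : x ∈ P.carrier) : P = Q := by
  rcases hij.eq_or_lt with rfl | hlt
  · exact dyadic_unique hQi hPj hxQ hxP
  · exfalso
    obtain ⟨j', rfl⟩ : ∃ j', j = j' + 1 := ⟨j - 1, by omega⟩
    obtain ⟨R, hR, hs, hpar⟩ := exists_parent hPj hxP
    obtain ⟨e, he, heE⟩ := hP.2.2 R hpar
    have := dyadic_nested (by omega : i ≤ j') hQi hR hxQ (hs hxP) he
    have h0 : e ∈ Q.carrier ∩ E := ⟨this, heE⟩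
    rw [hQ.2.1] at h0
    exact h0

lemma DE_eq_of_mem {P Q : Cube n} (hQ : Q ∈ DE E Q₀) (hP : P ∈ DE E Q₀)
    {x : Fin n → ℝ} (hxQ : x ∈ Q.carrier) (hxP : x ∈ P.carrier) : P = Q := by
  obtain ⟨i, hi⟩ := hQ.1
  obtain ⟨j, hj⟩ := hP.1
  rcases le_total i j with h | h
  · exact DE_eq_of_mem_aux h hQ hP hi hj hxQ hxP
  · exact (DE_eq_of_mem_aux h hP hQ hj hi hxP hxQ).symm

lemma exists_DE (hE : IsClosed E) {x : Fin n → ℝ} (hx : x ∈ Q₀.carrier) (hxE : x ∉ E) :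
    ∃ Q ∈ DE E Q₀, x ∈ Q.carrier := by
  have hex : ∃ j, ∃ P, IsDyadic Q₀ P j ∧ x ∈ P.carrier ∧ P.carrier ∩ E = ∅ := by
    obtain ⟨ε, hε, hball⟩ := Metric.isOpen_iff.1 hE.isOpen_compl x hxE
    obtain ⟨j, hj⟩ := pow_unbounded_of_one_lt (Q₀.l / ε) (one_lt_two (α := ℝ))
    obtain ⟨P, hP, hxP⟩ := exists_dcube hx j
    refine ⟨j, P, hP, hxP, ?_⟩
    rw [Set.eq_empty_iff_forall_notMem]
    rintro y ⟨hy, hyE⟩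
    refine hball ?_ hyE
    rw [Metric.mem_ball]
    refine (P.dist_lt hy hxP).trans_le ?_
    rw [hP.1, div_le_iff₀ (by positivity)]
    rw [div_lt_iff₀ hε] at hj
    linarith
  obtain ⟨Q, hQ, hxQ, hQE⟩ := Nat.find_spec hex
  refine ⟨Q, ⟨⟨_, hQ⟩, hQE, ?_⟩, hxQ⟩
  rintro P ⟨j, hj, hPj, hs⟩
  have hj' := dyadic_gen hj hQ
  by_contra hc
  rw [Set.not_nonempty_iff_eq_empty] at hc
  exact Nat.find_min hex (m := j) (by omega) ⟨P, hPj, hs hxQ, hc⟩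

instance : Countable {Q // Q ∈ dyadicFamily Q₀} := by
  have : dyadicFamily Q₀ ⊆ Set.range (fun p : ℕ × (Fin n → ℕ) => dcube Q₀ p.1 p.2) := by
    rintro Q ⟨j, hj⟩
    obtain ⟨k, -, rfl⟩ := hj.exists_eq
    exact ⟨(j, k), rfl⟩
  exact ((Set.countable_range _).mono this).to_subtype

lemma DE_countable (p : Cube n → Prop) : {Q | Q ∈ DE E Q₀ ∧ p Q}.Countable := by
  have h : (dyadicFamily Q₀).Countable := Set.countable_coe_iff.1 inferInstance
  exact h.mono fun Q hQ => hQ.1.1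

/-- Union of the cubes of `D_E(Q₀)` satisfying `p`. -/
def UU (E : Set (Fin n → ℝ)) (Q₀ : Cube n) (p : Cube n → Prop) : Set (Fin n → ℝ) :=
  ⋃ Q : {Q : Cube n // Q ∈ DE E Q₀ ∧ p Q}, (Q : Cube n).carrier

lemma mem_UU {p : Cube n → Prop} {x : Fin n → ℝ} :
    x ∈ UU E Q₀ p ↔ ∃ Q ∈ DE E Q₀, p Q ∧ x ∈ Q.carrier := by
  simp only [UU, mem_iUnion, Subtype.exists, exists_prop, and_assoc]

lemma UU_subset (p : Cube n → Prop) : UU E Q₀ p ⊆ Q₀.carrier := by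
  intro x hx
  obtain ⟨Q, hQ, -, hxQ⟩ := mem_UU.1 hx
  obtain ⟨j, hj⟩ := hQ.1
  exact dyadic_subset hj hxQ

lemma UU_meas (p : Cube n → Prop) : MeasurableSet (UU E Q₀ p) := by
  have := (DE_countable (E := E) (Q₀ := Q₀) p).to_subtype
  exact MeasurableSet.iUnion (ι := {Q | Q ∈ DE E Q₀ ∧ p Q}) fun Q => Q.1.meas

lemma tsum_eq_vol (p : Cube n → Prop) :
    ∑' Q : {Q : Cube n // Q ∈ DE E Q₀ ∧ p Q}, (Q : Cube n).vol = volume.real (UU E Q₀ p) := by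
  have : Countable {Q : Cube n // Q ∈ DE E Q₀ ∧ p Q} :=
    (DE_countable (E := E) (Q₀ := Q₀) p).to_subtype
  rw [Measure.real, UU, measure_iUnion]
  · rw [ENNReal.tsum_toReal_eq]
    · refine tsum_congr fun Q => ?_
      rw [Cube.volume_carrier, ENNReal.toReal_ofReal (Cube.vol_pos _).le]
    · intro Q; rw [Cube.volume_carrier]; exact ENNReal.ofReal_ne_top
  · intro P Q hPQ
    rw [Function.onFun, Set.disjoint_left]
    intro x hxP hxQ
    exact hPQ (Subtype.ext (DE_eq_of_mem Q.2.1 P.2.1 hxQ hxP))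
  · exact fun Q => Q.1.meas

lemma vol_ne_top (Q : Cube n) : volume Q.carrier ≠ ⊤ := by
  rw [Cube.volume_carrier]; exact ENNReal.ofReal_ne_top

lemma UU_ne_top (p : Cube n → Prop) : volume (UU E Q₀ p) ≠ ⊤ :=
  ne_top_of_le_ne_top (vol_ne_top Q₀) (measure_mono (UU_subset p))

lemma vol_real (Q : Cube n) : volume.real Q.carrier = Q.vol := by
  rw [Measure.real, Cube.volume_carrier, ENNReal.toReal_ofReal Q.vol_pos.le]

end Geometry

section Key
variable {n : ℕ} {E : Set (Fin n → ℝ)} {Q₀ : Cube n}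

lemma sumGE_eq (L : ℝ) : sumGE E Q₀ L = volume.real (UU E Q₀ (fun Q => L ≤ Q.l)) :=
  tsum_eq_vol _

lemma sumLE_eq (L : ℝ) : sumLE E Q₀ L = volume.real (UU E Q₀ (fun Q => Q.l ≤ L)) :=
  tsum_eq_vol _

lemma UU_le (p : Cube n → Prop) : volume.real (UU E Q₀ p) ≤ Q₀.vol := by
  rw [← vol_real]
  exact measureReal_mono (UU_subset p) (vol_ne_top Q₀)

lemma dyadic_l_le {Q : Cube n} (h : Q ∈ dyadicFamily Q₀) : Q.l ≤ Q₀.l := by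
  obtain ⟨j, hj⟩ := h
  rw [hj.1]
  exact div_le_self Q₀.l_pos.le (one_le_pow₀ one_le_two)

lemma vol_diff (hE0 : volume E = 0) (s : Set (Fin n → ℝ)) : volume (s \ E) = volume s :=
  measure_sdiff_null hE0

lemma vol_le_add (hE : IsClosed E) (hE0 : volume E = 0) (L : ℝ) :
    Q₀.vol ≤ sumLE E Q₀ L + sumGE E Q₀ L := by
  rw [sumLE_eq, sumGE_eq]
  refine le_trans ?_ (measureReal_union_le _ _)
  rw [← vol_real, Measure.real, ← vol_diff hE0]
  refine measureReal_mono ?_ ?_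
  · rintro x ⟨hx, hxE⟩
    obtain ⟨Q, hQ, hxQ⟩ := exists_DE hE hx hxE
    rcases le_total Q.l L with h | h
    · exact Or.inl (mem_UU.2 ⟨Q, hQ, h, hxQ⟩)
    · exact Or.inr (mem_UU.2 ⟨Q, hQ, h, hxQ⟩)
  · exact (measure_union_lt_top (UU_ne_top _).lt_top (UU_ne_top _).lt_top).ne

lemma sumLE_top (hE : IsClosed E) (hE0 : volume E = 0) : Q₀.vol ≤ sumLE E Q₀ Q₀.l := by
  rw [sumLE_eq, ← vol_real, Measure.real, ← vol_diff hE0]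
  refine measureReal_mono ?_ (UU_ne_top _)
  rintro x ⟨hx, hxE⟩
  obtain ⟨Q, hQ, hxQ⟩ := exists_DE hE hx hxE
  exact mem_UU.2 ⟨Q, hQ, dyadic_l_le hQ.1, hxQ⟩

lemma sumGE_zero {L : ℝ} (hL : Q₀.l < L) : sumGE E Q₀ L = 0 := by
  rw [sumGE_eq]
  have : UU E Q₀ (fun Q => L ≤ Q.l) = ∅ := by
    rw [Set.eq_empty_iff_forall_notMem]
    intro x hx
    obtain ⟨Q, hQ, h, -⟩ := mem_UU.1 hx
    have := dyadic_l_le hQ.1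
    linarith
  rw [this]; simp

lemma exists_sumGE (hE : IsClosed E) (hE0 : volume E = 0) :
    ∃ L > 0, 1 / 2 * Q₀.vol ≤ sumGE E Q₀ L := by
  set U : ℕ → Set (Fin n → ℝ) := fun k => UU E Q₀ (fun Q => 1 / ((k:ℝ) + 1) ≤ Q.l) with hU
  have hmono : Monotone U := by
    intro a b hab x hx
    obtain ⟨Q, hQ, h, hxQ⟩ := mem_UU.1 hx
    refine mem_UU.2 ⟨Q, hQ, le_trans ?_ h, hxQ⟩
    have : (a:ℝ) ≤ b := by exact_mod_cast hab
    gcongr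
  have ht := tendsto_measure_iUnion_atTop (μ := volume) hmono
  have hlt : ENNReal.ofReal (1 / 2 * Q₀.vol) < volume (⋃ k, U k) := by
    have h1 : volume Q₀.carrier ≤ volume (⋃ k, U k) := by
      rw [← vol_diff hE0]
      refine measure_mono ?_
      rintro x ⟨hx, hxE⟩
      obtain ⟨Q, hQ, hxQ⟩ := exists_DE hE hx hxE
      obtain ⟨k, hk⟩ := exists_nat_one_div_lt Q.l_pos
      exact mem_iUnion.2 ⟨k, mem_UU.2 ⟨Q, hQ, hk.le, hxQ⟩⟩
    refine lt_of_lt_of_le ?_ h1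
    have := Q₀.vol_pos
    rw [Cube.volume_carrier, ENNReal.ofReal_lt_ofReal_iff this]
    linarith
  obtain ⟨k, hk⟩ := (ht.eventually (lt_mem_nhds hlt)).exists
  refine ⟨1 / ((k:ℝ) + 1), by positivity, ?_⟩
  rw [sumGE_eq]
  exact (ENNReal.ofReal_le_iff_le_toReal (UU_ne_top _)).1 hk.le

lemma key_est (hE : IsClosed E) (hE0 : volume E = 0) {σ C₀ : ℝ} (hσ : 0 < σ) (hC₀ : 0 < C₀)
    (h : ∀ t ∈ Set.Ioo (0 : ℝ) 1, Lfun E Q₀ t ≤ C₀ / t ^ σ * Sfun E Q₀ t) :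
    ∃ M m : ℝ, 0 < m ∧ m ≤ M ∧ M ≤ Q₀.l ∧
      (∀ L > 0, sumLE E Q₀ L ≤ 2 * Q₀.vol * (C₀ * L / M) ^ (1 / σ)) ∧
      (∀ L > 0, sumGE E Q₀ L ≤ 2 * Q₀.vol * (C₀ * m / L) ^ (1 / σ)) := by
  have hV := Q₀.vol_pos
  have hLb : ∀ t, 0 < t → ∀ L ∈ Lset t Q₀ E, L ≤ Q₀.l := by
    rintro t ht L ⟨-, hL⟩
    by_contra hc
    push Not at hc
    rw [sumGE_zero hc] at hL
    have : 0 < t * Q₀.vol := by positivity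
    linarith
  have hLbdd : ∀ t, 0 < t → BddAbove (Lset t Q₀ E) := fun t ht => ⟨Q₀.l, hLb t ht⟩
  have hSbdd : ∀ t, BddBelow (Sset t Q₀ E) := fun t => ⟨0, fun L hL => hL.1⟩
  have hSne : ∀ t, t ≤ 1 → (Sset t Q₀ E).Nonempty := fun t ht =>
    ⟨Q₀.l, Q₀.l_pos.le, le_trans (by nlinarith) (sumLE_top hE hE0)⟩
  obtain ⟨L₁, hL₁, hL₁'⟩ := exists_sumGE (Q₀ := Q₀) hE hE0
  have hLne : (Lset (1/2) Q₀ E).Nonempty := ⟨L₁, hL₁.le, hL₁'⟩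
  set M := Lfun E Q₀ (1/2) with hM
  set m := Sfun E Q₀ (1/2) with hm
  have hM0 : 0 < M := hL₁.trans_le (le_csSup (hLbdd _ (by norm_num)) ⟨hL₁.le, hL₁'⟩)
  have hMm := h (1/2) (by norm_num)
  have hm0 : 0 < m := by
    by_contra hc
    push Not at hc
    have : C₀ / (1/2:ℝ) ^ σ * m ≤ 0 := mul_nonpos_of_nonneg_of_nonpos (by positivity) hc
    rw [← hM, ← hm] at hMm
    linarith
  -- passing from the distribution inequality to the power bound
  have powBound : ∀ F a b : ℝ, F ≤ Q₀.vol → 0 ≤ F → 0 < a → 0 < b →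
      (∀ t, 0 < t → t ≤ 1/2 → t * Q₀.vol ≤ F → a ≤ C₀ / t ^ σ * b) →
      F ≤ 2 * Q₀.vol * (C₀ * b / a) ^ (1 / σ) := by
    intro F a b hF1 hF0 ha hb hab
    rcases hF0.eq_or_lt with hF | hF
    · rw [← hF]; positivity
    set t := min (F / Q₀.vol) (1/2) with ht
    have ht0 : 0 < t := lt_min (by positivity) (by norm_num)
    have hh := hab t ht0 (min_le_right _ _) (by
      rw [← le_div_iff₀ hV]; exact min_le_left _ _)
    have hts : 0 < t ^ σ := by positivity
    have h1 : t ^ σ ≤ C₀ * b / a := by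
      rw [le_div_iff₀ ha]
      rw [div_mul_eq_mul_div, le_div_iff₀ hts] at hh
      linarith
    have h2 : t ≤ (C₀ * b / a) ^ (1 / σ) := by
      have := Real.rpow_le_rpow hts.le h1 (by positivity : 0 ≤ 1 / σ)
      rwa [← Real.rpow_mul ht0.le, mul_one_div_cancel hσ.ne', Real.rpow_one] at this
    have h3 : F / Q₀.vol ≤ 2 * t := by
      have : F / Q₀.vol ≤ 1 := by rw [div_le_one hV]; exact hF1
      have h0 : 0 < F / Q₀.vol := by positivity
      rcases min_choice (F / Q₀.vol) (1/2) with h' | h' <;> rw [ht, h'] <;> linarith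
    rw [div_le_iff₀ hV] at h3
    nlinarith
  refine ⟨M, m, hm0, ?_, csSup_le hLne (hLb _ (by norm_num)), ?_, ?_⟩
  · refine le_of_forall_lt_imp_le_of_dense ?_
    intro L hL
    rcases le_or_gt L 0 with h0 | h0
    · linarith
    refine le_csSup (hLbdd _ (by norm_num)) ⟨h0.le, ?_⟩
    have h1 : sumLE E Q₀ L < 1/2 * Q₀.vol := by
      by_contra hc
      push Not at hc
      have : m ≤ L := csInf_le (hSbdd _) ⟨h0.le, hc⟩
      linarith
    have := vol_le_add (Q₀ := Q₀) hE hE0 L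
    linarith
  · intro L hL
    refine powBound _ M L (by rw [sumLE_eq]; exact UU_le _) (by rw [sumLE_eq]; positivity) hM0 hL ?_
    intro t ht0 ht1 ht
    have e1 : Sfun E Q₀ t ≤ L := csInf_le (hSbdd _) ⟨hL.le, ht⟩
    have e2 : M ≤ Lfun E Q₀ t := by
      refine csSup_le_csSup (hLbdd _ ht0) hLne ?_
      rintro x ⟨hx, hx'⟩
      exact ⟨hx, le_trans (by nlinarith) hx'⟩
    refine (e2.trans (h t ⟨ht0, by linarith⟩)).trans ?_
    gcongr
  · intro L hL
    refine powBound _ L m (by rw [sumGE_eq]; exact UU_le _) (by rw [sumGE_eq]; positivity) hL hm0 ?_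
    intro t ht0 ht1 ht
    have e1 : L ≤ Lfun E Q₀ t := le_csSup (hLbdd _ ht0) ⟨hL.le, ht⟩
    have e2 : Sfun E Q₀ t ≤ m := by
      refine csInf_le_csInf (hSbdd _) (hSne _ (by norm_num)) ?_
      rintro x ⟨hx, hx'⟩
      exact ⟨hx, le_trans (by nlinarith) hx'⟩
    refine (e1.trans (h t ⟨ht0, by linarith⟩)).trans ?_
    gcongr

/-- A point of a cube of `D_E(Q₀)` is within twice the side length of `E`. -/
lemma infDist_le_of_DE (hQ₀ : (Q₀.carrier ∩ E).Nonempty) {Q : Cube n} (hQ : Q ∈ DE E Q₀)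
    {x : Fin n → ℝ} (hx : x ∈ Q.carrier) : Metric.infDist x E < 2 * Q.l := by
  obtain ⟨j, hj⟩ := hQ.1
  rcases j with _ | j
  · have := dyadic_zero _ hj
    subst this
    rw [hQ.2.1] at hQ₀
    exact absurd hQ₀ (by simp)
  · obtain ⟨P, hP, hs, hpar⟩ := exists_parent hj hx
    obtain ⟨e, he, heE⟩ := hQ.2.2 P hpar
    refine (Metric.infDist_le_dist_of_mem heE).trans_lt ((P.dist_lt (hs hx) he).trans_le ?_)
    rw [hP.1, hj.1, pow_succ]
    apply le_of_eq
    field_simp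

lemma vol_gt_le (hE : IsClosed E) (hQ₀ : (Q₀.carrier ∩ E).Nonempty) {t : ℝ} (ht : 0 < t) :
    volume ({x | t < Metric.infDist x E} ∩ Q₀.carrier) ≤ ENNReal.ofReal (sumGE E Q₀ (t / 2)) := by
  rw [sumGE_eq, Measure.real, ENNReal.ofReal_toReal (UU_ne_top _)]
  refine measure_mono ?_
  rintro x ⟨hx, hxQ⟩
  have hxE : x ∉ E := by
    intro hxE
    have := Metric.infDist_zero_of_mem hxE
    simp only [mem_ofPred_eq] at hx
    linarith
  obtain ⟨Q, hQ, hxQ'⟩ := exists_DE hE hxQ hxE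
  refine mem_UU.2 ⟨Q, hQ, ?_, hxQ'⟩
  have := infDist_le_of_DE hQ₀ hQ hxQ'
  simp only [mem_ofPred_eq] at hx
  linarith

/-- The points of the middle part of `Q₀` close to `E`. -/
lemma vol_lt_le (hE : IsClosed E) (hne : E.Nonempty) (hE0 : volume E = 0) (j : ℕ)
    (s : Set (Fin n → ℝ))
    (hs : ∀ x ∈ s, ∀ e, dist x e < Q₀.l / 2 ^ j → e ∈ Q₀.carrier) :
    volume ({x | Metric.infDist x E < Q₀.l / 2 ^ j} ∩ s) ≤
      ENNReal.ofReal (3 ^ n * sumLE E Q₀ (Q₀.l / 2 ^ j)) := by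
  set r := Q₀.l / 2 ^ j with hr
  have hr0 : 0 < r := div_pos Q₀.l_pos (by positivity)
  set S : Finset (Fin n → ℕ) :=
    (Fintype.piFinset fun _ => Finset.range (2 ^ j)).filter
      fun k => ((dcube Q₀ j k).carrier ∩ E).Nonempty with hS
  have hSd : ∀ k ∈ S, IsDyadic Q₀ (dcube Q₀ j k) j := by
    intro k hk
    refine dcube_isDyadic _ _ _ ?_
    simpa using (Finset.mem_filter.1 hk).1
  -- enlarged cubes
  set big : (Fin n → ℕ) → Cube n := fun k =>
    ⟨fun i => (dcube Q₀ j k).a i - r, 3 * r, by positivity⟩ with hbig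
  have hcov : {x | Metric.infDist x E < r} ∩ s ⊆ ⋃ k ∈ S, (big k).carrier := by
    rintro x ⟨hx, hxs⟩
    obtain ⟨e, heE, hd⟩ := (Metric.infDist_lt_iff hne).1 hx
    obtain ⟨P, hP, heP⟩ := exists_dcube (hs x hxs e hd) j
    obtain ⟨k, hk, rfl⟩ := hP.exists_eq
    refine mem_iUnion₂.2 ⟨k, ?_, ?_⟩
    · refine Finset.mem_filter.2 ⟨by simpa using hk, e, heP, heE⟩
    · intro i
      have h1 := heP i
      have h2 := (dist_pi_lt_iff hr0).1 hd i
      rw [Real.dist_eq, abs_lt] at h2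
      have h3 : (dcube Q₀ j k).l = r := rfl
      rw [h3] at h1
      simp only [hbig]
      constructor <;> linarith
  have hvb : ∀ k, volume (big k).carrier = 3 ^ n * volume (dcube Q₀ j k).carrier := by
    intro k
    have : (dcube Q₀ j k).l = r := rfl
    rw [Cube.volume_carrier, Cube.volume_carrier, Cube.vol, Cube.vol, this]
    simp only [hbig]
    rw [mul_pow, ENNReal.ofReal_mul (by positivity), ENNReal.ofReal_pow (by norm_num)]
    norm_num
  have hdisj : (S : Set (Fin n → ℕ)).PairwiseDisjoint fun k => (dcube Q₀ j k).carrier := by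
    intro k hk k' hk' hkk
    rw [Function.onFun, Set.disjoint_left]
    intro x hx hx'
    apply hkk
    have hx1 := mem_dcube.1 hx
    have hx2 := mem_dcube.1 hx'
    funext c
    obtain ⟨a1, a2⟩ := hx1 c
    obtain ⟨b1, b2⟩ := hx2 c
    have h1 : ((k c : ℕ) : ℝ) < ((k' c + 1 : ℕ) : ℝ) := by push_cast; linarith
    have h2 : ((k' c : ℕ) : ℝ) < ((k c + 1 : ℕ) : ℝ) := by push_cast; linarith
    have := Nat.cast_lt.1 h1
    have := Nat.cast_lt.1 h2
    omega
  have hsub : (⋃ k ∈ S, (dcube Q₀ j k).carrier) \ E ⊆ UU E Q₀ (fun Q => Q.l ≤ r) := by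
    rintro x ⟨hx, hxE⟩
    obtain ⟨k, hk, hxk⟩ := mem_iUnion₂.1 hx
    have hd := hSd k hk
    obtain ⟨Q, hQ, hxQ⟩ := exists_DE hE (dyadic_subset hd hxk) hxE
    refine mem_UU.2 ⟨Q, hQ, ?_, hxQ⟩
    obtain ⟨i, hi⟩ := hQ.1
    rcases le_total i j with hij | hij
    · exfalso
      obtain ⟨e, he, heE⟩ := (Finset.mem_filter.1 hk).2
      have h0 : e ∈ Q.carrier ∩ E := ⟨dyadic_nested hij hi hd hxQ hxk he, heE⟩
      rw [hQ.2.1] at h0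
      exact h0
    · rw [hi.1, hr]
      have := Q₀.l_pos
      gcongr
      norm_num
  calc volume ({x | Metric.infDist x E < r} ∩ s) ≤ volume (⋃ k ∈ S, (big k).carrier) :=
        measure_mono hcov
    _ ≤ ∑ k ∈ S, volume (big k).carrier := measure_biUnion_finset_le _ _
    _ = 3 ^ n * ∑ k ∈ S, volume (dcube Q₀ j k).carrier := by
        rw [Finset.mul_sum]; exact Finset.sum_congr rfl fun k _ => hvb k
    _ = 3 ^ n * volume ((⋃ k ∈ S, (dcube Q₀ j k).carrier) \ E) := by
        rw [vol_diff hE0, measure_biUnion_finset hdisj fun k _ => (dcube Q₀ j k).meas]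
    _ ≤ 3 ^ n * volume (UU E Q₀ (fun Q => Q.l ≤ r)) := by gcongr
    _ = _ := by
        rw [sumLE_eq, ENNReal.ofReal_mul (by positivity), ENNReal.ofReal_pow (by norm_num),
          Measure.real, ENNReal.ofReal_toReal (UU_ne_top _)]
        norm_num

end Key

section Final
variable {n : ℕ} {E : Set (Fin n → ℝ)}

lemma near_est (hE : IsClosed E) (hne : E.Nonempty) (hE0 : volume E = 0) {σ C₀ : ℝ}
    (hσ : 0 < σ) (hC₀ : 0 < C₀)
    (h : ∀ Q₀ : Cube n, (Q₀.carrier ∩ E).Nonempty → ∀ t ∈ Set.Ioo (0 : ℝ) 1,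
      Lfun E Q₀ t ≤ C₀ / t ^ σ * Sfun E Q₀ t) {α γ : ℝ} (hα : 0 < α) (hα' : α < 1 / σ)
    (hγ : 0 < γ) (hγ' : γ < 1 / σ) :
    ∃ K > 0, ∀ Q : Cube n, (∃ x ∈ Q.carrier, Metric.infDist x E < Q.l) →
      ∃ M m : ℝ, 0 < m ∧ m ≤ M ∧
        ∫⁻ x in Q.carrier, ENNReal.ofReal ((Metric.infDist x E)⁻¹ ^ α) ≤
          ENNReal.ofReal (K * Q.vol * (1 / M) ^ α) ∧
        ∫⁻ x in Q.carrier, ENNReal.ofReal (Metric.infDist x E ^ γ) ≤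
          ENNReal.ofReal (K * Q.vol * m ^ γ) := by
  set β := 1 / σ with hβ
  have hβ0 : 0 < β := by positivity
  have hαβ : 0 < β - α := by linarith
  have hγβ : 0 < β - γ := by linarith
  set B₁ : ℝ := 3 ^ n * (2 * (2 * C₀) ^ β) + 4 ^ β + 1 with hB₁
  set B₂ : ℝ := 2 * (2 * C₀) ^ β + 1 with hB₂
  have hB₁0 : 0 < B₁ := by positivity
  have hB₂0 : 0 < B₂ := by positivity
  have hmeas : Measurable fun x : Fin n → ℝ => Metric.infDist x E :=
    (Metric.continuous_infDist_pt E).measurable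
  refine ⟨4 ^ n * (B₁ * (1 + α / (β - α)) + B₂ * (1 + γ / (β - γ))), by positivity, ?_⟩
  rintro Q ⟨x₀, hx₀, hd₀⟩
  have hl := Q.l_pos
  set Q₀ : Cube n := ⟨fun i => Q.a i - Q.l, 4 * Q.l, by positivity⟩ with hQ₀
  have hV : Q₀.vol = 4 ^ n * Q.vol := by simp only [Cube.vol, hQ₀, mul_pow]
  have hV0 := Q₀.vol_pos
  have hmid : ∀ x ∈ Q.carrier, ∀ e, dist x e < Q.l → e ∈ Q₀.carrier := by
    intro x hx e he i
    have h1 := hx i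
    have h2 := (dist_pi_lt_iff hl).1 he i
    rw [Real.dist_eq, abs_lt] at h2
    simp only [hQ₀]
    constructor <;> linarith
  have hsub : Q.carrier ⊆ Q₀.carrier := fun x hx => hmid x hx x (by simpa using hl)
  have hmeet : (Q₀.carrier ∩ E).Nonempty := by
    obtain ⟨e, heE, hd⟩ := (Metric.infDist_lt_iff hne).1 hd₀
    exact ⟨e, hmid x₀ hx₀ e hd, heE⟩
  obtain ⟨M, m, hm0, hmM, hMl, hF, hG⟩ := key_est hE hE0 hσ hC₀ (h Q₀ hmeet)
  have hM0 : 0 < M := hm0.trans_le hmM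
  have hQ0v : volume Q.carrier ≤ ENNReal.ofReal Q₀.vol := by
    rw [← Cube.volume_carrier]; exact measure_mono hsub
  have hlt : ∀ r, 0 < r → volume ({x | Metric.infDist x E < r} ∩ Q.carrier) ≤
      ENNReal.ofReal (Q₀.vol * B₁ * (r / M) ^ β) := by
    intro r hr
    have hrM : 0 < (r / M) ^ β := by positivity
    rcases le_or_gt r Q.l with hrl | hrl
    · obtain ⟨j, hj1, hj2⟩ := exists_nat_pow_near (x := Q.l / r) (y := (2:ℝ))
        (by rwa [one_le_div hr]) one_lt_two
      have h2j : (0:ℝ) < 2 ^ j := by positivity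
      rw [le_div_iff₀ hr] at hj1
      rw [div_lt_iff₀ hr, pow_succ] at hj2
      have e : Q₀.l / 2 ^ (j + 2) = Q.l / 2 ^ j := by
        simp only [hQ₀]; rw [pow_add]; field_simp; norm_num
      have hrj : r ≤ Q₀.l / 2 ^ (j + 2) := by
        rw [e, le_div_iff₀ h2j]; linarith
      have hrj2 : Q₀.l / 2 ^ (j + 2) ≤ 2 * r := by
        rw [e, div_le_iff₀ h2j]; linarith
      have hle : Q₀.l / 2 ^ (j + 2) ≤ Q.l := by
        rw [e]; exact div_le_self hl.le (one_le_pow₀ one_le_two)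
      have hpos : 0 < Q₀.l / 2 ^ (j + 2) := hr.trans_le hrj
      calc _ ≤ volume ({x | Metric.infDist x E < Q₀.l / 2 ^ (j + 2)} ∩ Q.carrier) := by
            refine measure_mono ?_
            rintro x ⟨hx, hxQ⟩
            exact ⟨lt_of_lt_of_le hx hrj, hxQ⟩
        _ ≤ _ := vol_lt_le hE hne hE0 (j + 2) Q.carrier
            (fun x hx e he => hmid x hx e (he.trans_le hle))
        _ ≤ _ := by
            apply ENNReal.ofReal_le_ofReal
            calc 3 ^ n * sumLE E Q₀ (Q₀.l / 2 ^ (j + 2))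
                ≤ 3 ^ n * (2 * Q₀.vol * (C₀ * (Q₀.l / 2 ^ (j + 2)) / M) ^ β) := by
                  gcongr; exact hF _ hpos
              _ ≤ 3 ^ n * (2 * Q₀.vol * ((2 * C₀) * (r / M)) ^ β) := by
                  gcongr 3 ^ n * (2 * Q₀.vol * ?_ ^ β)
                  calc C₀ * (Q₀.l / 2 ^ (j + 2)) / M ≤ C₀ * (2 * r) / M := by gcongr
                    _ = _ := by ring
              _ = Q₀.vol * (3 ^ n * (2 * (2 * C₀) ^ β)) * (r / M) ^ β := by
                  rw [Real.mul_rpow (by positivity) (by positivity)]; ring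
              _ ≤ _ := by
                  gcongr
                  rw [hB₁]
                  have : (0:ℝ) < 4 ^ β := by positivity
                  linarith
    · calc _ ≤ volume Q.carrier := measure_mono inter_subset_right
        _ ≤ _ := hQ0v
        _ ≤ _ := by
            apply ENNReal.ofReal_le_ofReal
            have h1 : 1 ≤ (4 * (r / M)) ^ β := by
              apply Real.one_le_rpow _ hβ0.le
              rw [mul_div_assoc', one_le_div hM0]
              have : Q₀.l = 4 * Q.l := rfl
              linarith
            rw [Real.mul_rpow (by norm_num) (by positivity)] at h1
            have h2 : 4 ^ β * (r / M) ^ β ≤ B₁ * (r / M) ^ β := by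
              gcongr
              rw [hB₁]
              have : (0:ℝ) < 3 ^ n * (2 * (2 * C₀) ^ β) := by positivity
              linarith
            rw [mul_assoc]
            exact le_mul_of_one_le_right hV0.le (h1.trans h2)
  have hgt : ∀ t, 0 < t → volume ({x | t < Metric.infDist x E} ∩ Q.carrier) ≤
      ENNReal.ofReal (Q₀.vol * B₂ * (m / t) ^ β) := by
    intro t ht
    calc _ ≤ volume ({x | t < Metric.infDist x E} ∩ Q₀.carrier) := by
          gcongr
      _ ≤ _ := vol_gt_le hE hmeet ht
      _ ≤ _ := by
          apply ENNReal.ofReal_le_ofReal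
          have htm : 0 < m / t := by positivity
          calc _ ≤ 2 * Q₀.vol * (C₀ * m / (t / 2)) ^ β := hG _ (by positivity)
            _ = 2 * Q₀.vol * ((2 * C₀) * (m / t)) ^ β := by
                congr 2; field_simp
            _ = Q₀.vol * (2 * (2 * C₀) ^ β) * (m / t) ^ β := by
                rw [Real.mul_rpow (by positivity) htm.le]; ring
            _ ≤ _ := by
                gcongr
                rw [hB₂]; linarith
  have hB₁1 : 1 ≤ B₁ := by
    have : (0:ℝ) < 3 ^ n * (2 * (2 * C₀) ^ β) + 4 ^ β := by positivity
    rw [hB₁]; linarith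
  have hB₂1 : 1 ≤ B₂ := by
    have : (0:ℝ) < 2 * (2 * C₀) ^ β := by positivity
    rw [hB₂]; linarith
  refine ⟨M, m, hm0, hmM, ?_, ?_⟩
  · refine (layer_est (volume.restrict Q.carrier) (fun x => (Metric.infDist x E)⁻¹) hmeas.inv
      (fun x => inv_nonneg.2 Metric.infDist_nonneg) (Q₀.vol * B₁) (1 / M) β α (by positivity)
      (by positivity) hα hα' ?_ ?_).trans ?_
    · rw [Measure.restrict_apply_univ]
      exact hQ0v.trans (ENNReal.ofReal_le_ofReal (le_mul_of_one_le_right hV0.le hB₁1))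
    · intro t ht
      have hms : MeasurableSet {x : Fin n → ℝ | t < (Metric.infDist x E)⁻¹} :=
        measurableSet_lt measurable_const hmeas.inv
      rw [Measure.restrict_apply hms]
      refine (measure_mono ?_).trans ((hlt (1 / t) (by positivity)).trans (le_of_eq ?_))
      · rintro x ⟨hx, hxQ⟩
        refine ⟨?_, hxQ⟩
        simp only [mem_ofPred_eq] at hx ⊢
        have hpos : 0 < Metric.infDist x E := inv_pos.1 (ht.trans hx)
        rw [one_div]
        exact (lt_inv_comm₀ ht hpos).1 hx
      · congr 3; rw [div_div, div_div, mul_comm]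
    · apply ENNReal.ofReal_le_ofReal
      rw [hV]
      have : 0 ≤ 4 ^ n * Q.vol * (1 / M) ^ α * (B₂ * (1 + γ / (β - γ))) := by
        have := Q.vol_pos
        positivity
      nlinarith
  · refine (layer_est (volume.restrict Q.carrier) (fun x => Metric.infDist x E) hmeas
      (fun x => Metric.infDist_nonneg) (Q₀.vol * B₂) m β γ (by positivity)
      hm0 hγ hγ' ?_ ?_).trans ?_
    · rw [Measure.restrict_apply_univ]
      exact hQ0v.trans (ENNReal.ofReal_le_ofReal (le_mul_of_one_le_right hV0.le hB₂1))
    · intro t ht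
      rw [Measure.restrict_apply (measurableSet_lt measurable_const hmeas)]
      exact hgt t ht
    · apply ENNReal.ofReal_le_ofReal
      rw [hV]
      have : 0 ≤ 4 ^ n * Q.vol * m ^ γ * (B₁ * (1 + α / (β - α))) := by
        have := Q.vol_pos
        positivity
      nlinarith

lemma avg_le {Q : Cube n} {f : (Fin n → ℝ) → ℝ} (hf : Measurable f) (hf0 : ∀ x, 0 ≤ f x)
    {B : ℝ} (hB : 0 ≤ B)
    (h : ∫⁻ x in Q.carrier, ENNReal.ofReal (f x) ≤ ENNReal.ofReal (B * Q.vol)) :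
    (∫ x in Q.carrier, f x) / Q.vol ≤ B := by
  have := Q.vol_pos
  rw [div_le_iff₀ this, integral_eq_lintegral_of_nonneg_ae (Filter.Eventually.of_forall hf0)
    hf.aestronglyMeasurable]
  exact ENNReal.toReal_le_of_le_ofReal (by positivity) h

lemma lint_le {Q : Cube n} {f : (Fin n → ℝ) → ℝ} {B : ℝ} (hB : 0 ≤ B)
    (h : ∀ x ∈ Q.carrier, f x ≤ B) :
    ∫⁻ x in Q.carrier, ENNReal.ofReal (f x) ≤ ENNReal.ofReal (B * Q.vol) := by
  calc _ ≤ ∫⁻ x in Q.carrier, ENNReal.ofReal B :=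
        setLIntegral_mono' Q.meas fun x hx => ENNReal.ofReal_le_ofReal (h x hx)
    _ = _ := by
        rw [setLIntegral_const, Cube.volume_carrier, ENNReal.ofReal_mul hB]

end Final
/-- Converse: if `𝓛_{Q₀}(t) ≤ (C₀/t^σ) 𝓢_{Q₀}(t)` for all cubes meeting `E` and all
`t ∈ (0,1)`, then `dist(·,E)^{-α} ∈ A_p` whenever `0 < α < min{1/σ, (p−1)/σ}`. -/
theorem stmt12 {n : ℕ} (E : Set (Fin n → ℝ)) (hE : IsClosed E) (hne : E.Nonempty)
    (hE0 : volume E = 0) (σ C₀ : ℝ) (hσ : 0 < σ) (hC₀ : 0 < C₀)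
    (h : ∀ Q₀ : Cube n, (Q₀.carrier ∩ E).Nonempty → ∀ t ∈ Set.Ioo (0 : ℝ) 1,
      Lfun E Q₀ t ≤ C₀ / t ^ σ * Sfun E Q₀ t) :
    ∀ p : ℝ, 1 < p → ∀ α : ℝ, 0 < α → α < min (1 / σ) ((p - 1) / σ) →
      IsAp p (fun x => Metric.infDist x E ^ (-α)) := by
  intro p hp α hα hαm
  have hp1 : 0 < p - 1 := by linarith
  have hα1 : α < 1 / σ := hαm.trans_le (min_le_left _ _)
  have hα2 : α < (p - 1) / σ := hαm.trans_le (min_le_right _ _)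
  set γ := α / (p - 1) with hγdef
  have hγ : 0 < γ := by positivity
  have hγ' : γ < 1 / σ := by
    rw [hγdef, div_lt_iff₀ hp1]
    calc α < (p - 1) / σ := hα2
      _ = _ := by ring
  have hγp : γ * (p - 1) = α := by rw [hγdef]; field_simp
  have hmeas : Measurable fun x : Fin n → ℝ => Metric.infDist x E :=
    (Metric.continuous_infDist_pt E).measurable
  have hw : ∀ x : Fin n → ℝ, Metric.infDist x E ^ (-α) = (Metric.infDist x E)⁻¹ ^ α := fun x => by
    rw [Real.rpow_neg Metric.infDist_nonneg, Real.inv_rpow Metric.infDist_nonneg]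
  have hw' : ∀ x : Fin n → ℝ,
      (Metric.infDist x E ^ (-α)) ^ (-1 / (p - 1)) = Metric.infDist x E ^ γ := fun x => by
    rw [← Real.rpow_mul Metric.infDist_nonneg]
    congr 1
    rw [hγdef]; ring
  have hm1 : Measurable fun x : Fin n → ℝ => (Metric.infDist x E)⁻¹ ^ α :=
    hmeas.inv.pow_const α
  have hm2 : Measurable fun x : Fin n → ℝ => Metric.infDist x E ^ γ := hmeas.pow_const γ
  have hn1 : ∀ x : Fin n → ℝ, 0 ≤ (Metric.infDist x E)⁻¹ ^ α := fun x =>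
    Real.rpow_nonneg (inv_nonneg.2 Metric.infDist_nonneg) _
  have hn2 : ∀ x : Fin n → ℝ, 0 ≤ Metric.infDist x E ^ γ := fun x =>
    Real.rpow_nonneg Metric.infDist_nonneg _
  obtain ⟨K, hK, hnear⟩ := near_est hE hne hE0 hσ hC₀ h hα hα1 hγ hγ'
  refine ⟨?_, ?_, ?_⟩
  · have : ∀ᵐ x : Fin n → ℝ, x ∉ E := measure_eq_zero_iff_ae_notMem.1 hE0
    filter_upwards [this] with x hx
    exact Real.rpow_pos_of_pos ((hE.notMem_iff_infDist_pos hne).1 hx) _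
  · intro x
    set d := Metric.infDist x E with hd
    have hd0 : 0 ≤ d := Metric.infDist_nonneg
    let Q : Cube n := ⟨fun i => x i - (d + 1), 2 * (d + 1), by positivity⟩
    have hball : Metric.ball x (d + 1) ⊆ Q.carrier := by
      intro y hy i
      have h2 := (dist_pi_lt_iff (by positivity)).1 (Metric.mem_ball.1 hy) i
      rw [Real.dist_eq, abs_lt] at h2
      change x i - (d + 1) ≤ y i ∧ y i < x i - (d + 1) + 2 * (d + 1)
      constructor <;> linarith
    have hQn : Q.carrier ∈ nhds x := Filter.mem_of_superset
      (Metric.ball_mem_nhds x (by positivity)) hball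
    obtain ⟨M, m, hm0, hmM, h1, -⟩ := hnear Q ⟨x, mem_of_mem_nhds hQn, by
      change d < 2 * (d + 1); linarith⟩
    refine ⟨Q.carrier, hQn, ?_⟩
    simp only [hw]
    refine ⟨hm1.aestronglyMeasurable, ?_⟩
    rw [hasFiniteIntegral_iff_ofReal (Filter.Eventually.of_forall hn1)]
    exact h1.trans_lt ENNReal.ofReal_lt_top
  · refine ⟨K * K ^ (p - 1) + 2 ^ α * 2 ^ α, by positivity, fun Q => ?_⟩
    rw [if_neg (by linarith : p ≠ 1)]
    simp only [hw']
    simp only [hw]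
    have hQv := Q.vol_pos
    have comb : ∀ B₁ B₂ B : ℝ, 0 ≤ B₁ → 0 ≤ B₂ → B₁ * B₂ ^ (p - 1) ≤ B →
        ∫⁻ x in Q.carrier, ENNReal.ofReal ((Metric.infDist x E)⁻¹ ^ α) ≤
          ENNReal.ofReal (B₁ * Q.vol) →
        ∫⁻ x in Q.carrier, ENNReal.ofReal (Metric.infDist x E ^ γ) ≤
          ENNReal.ofReal (B₂ * Q.vol) →
        ((∫ x in Q.carrier, (Metric.infDist x E)⁻¹ ^ α) / Q.vol) *
          ((∫ x in Q.carrier, Metric.infDist x E ^ γ) / Q.vol) ^ (p - 1) ≤ B := by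
      intro B₁ B₂ B hB₁ hB₂ hB h1 h2
      refine le_trans ?_ hB
      have i1 := avg_le hm1 hn1 hB₁ h1
      have i2 := avg_le hm2 hn2 hB₂ h2
      have i3 : 0 ≤ (∫ x in Q.carrier, Metric.infDist x E ^ γ) / Q.vol :=
        div_nonneg (integral_nonneg hn2) hQv.le
      gcongr
    by_cases hQ : ∃ x ∈ Q.carrier, Metric.infDist x E < Q.l
    · obtain ⟨M, m, hm0, hmM, h1, h2⟩ := hnear Q hQ
      have hM0 : 0 < M := hm0.trans_le hmM
      refine comb (K * (1 / M) ^ α) (K * m ^ γ) _ (by positivity) (by positivity) ?_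
        (h1.trans_eq (by congr 1; ring)) (h2.trans_eq (by congr 1; ring))
      rw [Real.mul_rpow hK.le (by positivity), ← Real.rpow_mul hm0.le, hγp]
      have : (1 / M) ^ α * m ^ α ≤ 1 := by
        rw [← Real.mul_rpow (by positivity) hm0.le]
        apply Real.rpow_le_one (by positivity) _ hα.le
        rw [one_div_mul_eq_div, div_le_one hM0]; exact hmM
      calc K * (1 / M) ^ α * (K ^ (p - 1) * m ^ α)
          = K * K ^ (p - 1) * ((1 / M) ^ α * m ^ α) := by ring
        _ ≤ K * K ^ (p - 1) * 1 := by gcongr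
        _ ≤ _ := by
          have : (0:ℝ) < 2 ^ α * 2 ^ α := by positivity
          linarith
    · push Not at hQ
      have hl := Q.l_pos
      have ha : Q.a ∈ Q.carrier := fun i => ⟨le_rfl, by linarith⟩
      set d := Metric.infDist Q.a E with hd
      have hdl := hQ _ ha
      have hd0 : 0 < d := hl.trans_le hdl
      have hb1 : ∀ x ∈ Q.carrier, d / 2 ≤ Metric.infDist x E := fun x hx => by
        have e1 := Metric.infDist_le_infDist_add_dist (s := E) (x := Q.a) (y := x)
        have e2 := Q.dist_lt ha hx
        have e3 := hQ x hx
        linarith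
      have hb2 : ∀ x ∈ Q.carrier, Metric.infDist x E ≤ 2 * d := fun x hx => by
        have e1 := Metric.infDist_le_infDist_add_dist (s := E) (x := x) (y := Q.a)
        have e2 := Q.dist_lt hx ha
        linarith
      refine comb ((d / 2)⁻¹ ^ α) ((2 * d) ^ γ) _ (by positivity) (by positivity) ?_
        (lint_le (by positivity) fun x hx => ?_) (lint_le (by positivity) fun x hx => ?_)
      · rw [← Real.rpow_mul (by positivity), hγp, ← Real.mul_rpow (by positivity) (by positivity),
          ← Real.mul_rpow (by positivity) (by positivity)]
        have : (d / 2)⁻¹ * (2 * d) = 2 * 2 := by field_simp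
        rw [this]
        have : 0 < K * K ^ (p - 1) := by positivity
        linarith
      · have := hb1 x hx
        have h3 : 0 < d / 2 := by positivity
        exact Real.rpow_le_rpow (inv_nonneg.2 Metric.infDist_nonneg)
          (inv_anti₀ h3 this) hα.le
      · have := hb2 x hx
        exact Real.rpow_le_rpow Metric.infDist_nonneg this hγ.le
end

section
/- Let E ⊂ ℝⁿ be closed and non-empty. Suppose there exist C₀ > 0 and 0 < s < 1/(1+2ⁿ) such that 𝓛_{Q₀}(s) ≤ C₀ 𝓢_{Q₀}(s) for every cube Q₀ intersecting E (and |E| = 0). Then there exist constants σ̃, C̃₀ > 0 (one may take C̃₀ = C₀³ and σ̃ = 2 log C₀ / log((1−s)/(2ⁿ s))) such that 𝓛_{Q₀}(t) ≤ (C̃₀/t^{σ̃}) 𝓢_{Q₀}(t) for every cube Q₀ intersecting E and every t ∈ (0,1). -/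
open MeasureTheory Set
open scoped Classical

namespace Cube

@[ext]
theorem ext'_s15 {n : ℕ} {P Q : Cube n} (h1 : P.a = Q.a) (h2 : P.l = Q.l) : P = Q := by
  cases P; cases Q; simp_all

/-- dyadic children -/
noncomputable def child {n : ℕ} (P : Cube n) (e : Fin n → Fin 2) : Cube n where
  a := fun i => P.a i + ((e i : ℕ) : ℝ) * (P.l / 2)
  l := P.l / 2
  l_pos := half_pos P.l_pos

theorem vol_pos_s15 {n : ℕ} (P : Cube n) : 0 < P.vol := pow_pos P.l_pos n

theorem child_vol {n : ℕ} (P : Cube n) (e : Fin n → Fin 2) : P.vol = 2 ^ n * (P.child e).vol := by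
  simp only [vol, child, div_pow]
  field_simp

theorem child_subset {n : ℕ} (P : Cube n) (e : Fin n → Fin 2) :
    (P.child e).carrier ⊆ P.carrier := by
  intro x hx i
  have h := hx i
  have hl := P.l_pos
  simp only [child] at h
  have : (e i : ℕ) = 0 ∨ (e i : ℕ) = 1 := by omega
  rcases this with h0 | h0 <;> rw [h0] at h <;> push_cast at h <;> constructor <;> linarith [h.1, h.2]

theorem exists_child {n : ℕ} (P : Cube n) {x : Fin n → ℝ} (hx : x ∈ P.carrier) :
    ∃ e, x ∈ (P.child e).carrier := by
  refine ⟨fun i => if x i < P.a i + P.l / 2 then 0 else 1, fun i => ?_⟩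
  have h := hx i
  simp only [child]
  split_ifs with h1
  · simp; constructor <;> linarith [h.1, h.2]
  · simp; constructor <;> linarith [h.1, h.2]

theorem child_unique {n : ℕ} (P : Cube n) {x : Fin n → ℝ} {e e' : Fin n → Fin 2}
    (h : x ∈ (P.child e).carrier) (h' : x ∈ (P.child e').carrier) : e = e' := by
  funext i
  have h1 := h i
  have h2 := h' i
  have hl := P.l_pos
  simp only [child] at h1 h2
  have a1 : (e i : ℕ) = 0 ∨ (e i : ℕ) = 1 := by omega
  have a2 : (e' i : ℕ) = 0 ∨ (e' i : ℕ) = 1 := by omega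
  apply Fin.ext
  rcases a1 with a1 | a1 <;> rcases a2 with a2 | a2 <;> rw [a1] at h1 ⊢ <;> rw [a2] at h2 ⊢ <;>
    push_cast at h1 h2 <;> exfalso <;> linarith [h1.1, h1.2, h2.1, h2.2]

theorem corner_mem {n : ℕ} (P : Cube n) : P.a ∈ P.carrier := fun i => ⟨le_rfl, by linarith [P.l_pos]⟩

theorem volume_carrier_s15 {n : ℕ} (P : Cube n) : volume P.carrier = ENNReal.ofReal P.vol := by
  have : P.carrier = Set.pi Set.univ (fun i => Set.Ico (P.a i) (P.a i + P.l)) := by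
    ext x; simp [carrier]
  rw [this, Real.volume_pi_Ico]
  simp [vol, ENNReal.ofReal_pow P.l_pos.le]

end Cube

section dyadic
variable {n : ℕ}

theorem isDyadic_zero {P Q : Cube n} : IsDyadic P Q 0 ↔ Q = P := by
  constructor
  · rintro ⟨h1, k, hk, h2⟩
    ext i
    · have : k i = 0 := by have := hk i; simpa using this
      simp [h2 i, this]
    · simpa using h1
  · rintro rfl
    exact ⟨by simp, fun _ => 0, by simp, by simp⟩

theorem isDyadic_succ {P Q : Cube n} {j : ℕ} :
    IsDyadic P Q (j + 1) ↔ ∃ e, IsDyadic (P.child e) Q j := by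
  constructor
  · rintro ⟨h1, k, hk, h2⟩
    refine ⟨fun i => if k i < 2 ^ j then 0 else 1, ?_, fun i => if k i < 2 ^ j then k i else k i - 2 ^ j, ?_, ?_⟩
    · simp only [Cube.child]; rw [h1, pow_succ]; field_simp
    · intro i
      have := hk i
      rw [pow_succ] at this
      dsimp only
      split_ifs <;> omega
    · intro i
      simp only [Cube.child]
      rw [h2 i]
      split_ifs with h3
      · simp; rw [pow_succ]; field_simp
      · rw [Nat.cast_sub (not_lt.mp h3)]; simp; rw [pow_succ]; field_simp; ring
  · rintro ⟨e, h1, k, hk, h2⟩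
    simp only [Cube.child] at h1 h2
    refine ⟨by rw [h1, pow_succ]; field_simp, fun i => k i + e i * 2 ^ j, ?_, ?_⟩
    · intro i
      have := hk i
      have a1 : (e i : ℕ) = 0 ∨ (e i : ℕ) = 1 := by omega
      dsimp only
      rw [pow_succ]
      rcases a1 with a1 | a1 <;> rw [a1] <;> omega
    · intro i
      rw [h2 i]; push_cast; rw [pow_succ]; field_simp; ring

theorem IsDyadic.subset {j : ℕ} : ∀ {P Q : Cube n}, IsDyadic P Q j → Q.carrier ⊆ P.carrier := by
  induction j with
  | zero => intro P Q h; rw [isDyadic_zero] at h; rw [h]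
  | succ j ih =>
    intro P Q h
    obtain ⟨e, he⟩ := isDyadic_succ.1 h
    exact (ih he).trans (P.child_subset e)

theorem IsDyadic.gen_unique {P Q : Cube n} {i j : ℕ} (h : IsDyadic P Q i) (h' : IsDyadic P Q j) :
    i = j := by
  have h1 := h.1.symm.trans h'.1
  have := P.l_pos
  have h2 : (2 : ℝ) ^ i = 2 ^ j := by
    field_simp at h1
    exact h1.symm
  exact pow_right_injective₀ (by norm_num) (by norm_num) h2

theorem IsDyadic.l_le {P Q : Cube n} {j : ℕ} (h : IsDyadic P Q j) : Q.l ≤ P.l := by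
  rw [h.1]
  exact div_le_self P.l_pos.le (one_le_pow₀ (by norm_num))

theorem exists_parent_s15 {j : ℕ} : ∀ {P Q : Cube n}, IsDyadic P Q (j + 1) →
    ∃ R, IsDyadic P R j ∧ Q.carrier ⊆ R.carrier := by
  induction j with
  | zero => intro P Q h; exact ⟨P, isDyadic_zero.2 rfl, h.subset⟩
  | succ j ih =>
    intro P Q h
    obtain ⟨e, he⟩ := isDyadic_succ.1 h
    obtain ⟨R, hR, hQ⟩ := ih he
    exact ⟨R, isDyadic_succ.2 ⟨e, hR⟩, hQ⟩

variable (E : Set (Fin n → ℝ))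

theorem DE_disj {P : Cube n} (hP : P.carrier ∩ E = ∅) : DE E P = {P} := by
  ext Q
  constructor
  · rintro ⟨⟨j, hj⟩, h1, h2⟩
    cases j with
    | zero => exact isDyadic_zero.1 hj
    | succ j =>
      obtain ⟨R, hR, hQ⟩ := exists_parent_s15 hj
      obtain ⟨x, hx⟩ := h2 R ⟨j, hj, hR, hQ⟩
      have : x ∈ P.carrier ∩ E := ⟨hR.subset hx.1, hx.2⟩
      simp [hP] at this
  · rintro rfl
    refine ⟨⟨0, isDyadic_zero.2 rfl⟩, hP, ?_⟩
    rintro R ⟨j, h1, -⟩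
    have := h1.gen_unique (isDyadic_zero.2 rfl)
    omega

theorem DE_meets {P : Cube n} (hP : (P.carrier ∩ E).Nonempty) (Q : Cube n) :
    Q ∈ DE E P ↔ ∃ e, Q ∈ DE E (P.child e) := by
  constructor
  · rintro ⟨⟨j, hj⟩, h1, h2⟩
    cases j with
    | zero =>
      rw [isDyadic_zero] at hj
      subst hj
      simp [h1] at hP
    | succ j =>
      obtain ⟨e, he⟩ := isDyadic_succ.1 hj
      refine ⟨e, ⟨j, he⟩, h1, ?_⟩
      rintro R ⟨i, h3, h4, h5⟩
      exact h2 R ⟨i + 1, isDyadic_succ.2 ⟨e, h3⟩, isDyadic_succ.2 ⟨e, h4⟩, h5⟩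
  · rintro ⟨e, ⟨j, hj⟩, h1, h2⟩
    have hd := isDyadic_succ.2 ⟨e, hj⟩
    refine ⟨⟨j + 1, hd⟩, h1, ?_⟩
    rintro R ⟨i, h3, h4, h5⟩
    have hij := h3.gen_unique hd
    cases i with
    | zero => rw [isDyadic_zero.1 h4]; exact hP
    | succ i =>
      obtain ⟨e', h6⟩ := isDyadic_succ.1 h4
      have hee : e = e' := P.child_unique (hj.subset Q.corner_mem) (h6.subset (h5 Q.corner_mem))
      subst hee
      obtain rfl : j = i + 1 := by omega
      exact h2 R ⟨i, hj, h6, h5⟩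

theorem DE_cover {x : Fin n → ℝ} {r : ℝ} (hr : ∀ y ∈ E, r ≤ dist y x) (hr0 : 0 < r) (m : ℕ) :
    ∀ P : Cube n, x ∈ P.carrier → P.l / 2 ^ m < r → ∃ Q ∈ DE E P, x ∈ Q.carrier := by
  induction m with
  | zero =>
    intro P hx hl
    simp only [pow_zero, div_one] at hl
    have hP : P.carrier ∩ E = ∅ := by
      by_contra hne
      obtain ⟨y, hy1, hy2⟩ := Set.nonempty_iff_ne_empty.2 hne
      have : dist y x < r := by
        rw [dist_pi_lt_iff hr0]
        intro i
        rw [Real.dist_eq, abs_lt]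
        constructor <;> linarith [(hy1 i).1, (hy1 i).2, (hx i).1, (hx i).2]
      linarith [hr y hy2]
    rw [DE_disj E hP]
    exact ⟨P, rfl, hx⟩
  | succ m ih =>
    intro P hx hl
    by_cases hP : (P.carrier ∩ E).Nonempty
    · obtain ⟨e, he⟩ := P.exists_child hx
      obtain ⟨Q, hQ, hxQ⟩ := ih (P.child e) he (by
        simp only [Cube.child]; rw [pow_succ] at hl; rw [div_div, mul_comm]; exact hl)
      exact ⟨Q, (DE_meets E hP Q).2 ⟨e, hQ⟩, hxQ⟩
    · rw [Set.not_nonempty_iff_eq_empty] at hP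
      rw [DE_disj E hP]
      exact ⟨P, rfl, hx⟩

theorem DE_countable_s15 (P : Cube n) : (DE E P).Countable := by
  have : dyadicFamily P = ⋃ j, {Q | IsDyadic P Q j} := by ext; simp [dyadicFamily]
  refine Set.Countable.mono (s₂ := dyadicFamily P) (fun Q hQ => hQ.1) ?_
  rw [this]
  refine Set.countable_iUnion fun j => Set.Finite.countable ?_
  induction j generalizing P with
  | zero => simp [isDyadic_zero]
  | succ j ih =>
    simp only [isDyadic_succ, Set.ofPred_exists]
    exact Set.finite_iUnion fun e => ih _ (by ext; simp [dyadicFamily])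

/-- selected cubes -/
def Sel (p : ℝ → Prop) (P : Cube n) : Set (Cube n) := {Q | Q ∈ DE E P ∧ p Q.l}

/-- extended total volume of the selected cubes -/
noncomputable def WW (p : ℝ → Prop) (P : Cube n) : ENNReal :=
  ∑' Q : Cube n, (Sel E p P).indicator (fun Q => ENNReal.ofReal Q.vol) Q

/-- total volume of the selected cubes -/
noncomputable def ww (p : ℝ → Prop) (P : Cube n) : ℝ := (WW E p P).toReal

theorem ww_eq (p : ℝ → Prop) (P : Cube n) :
    ww E p P = ∑' Q : {Q : Cube n // Q ∈ DE E P ∧ p Q.l}, (Q : Cube n).vol := by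
  have : WW E p P = ∑' Q : {Q : Cube n // Q ∈ DE E P ∧ p Q.l}, ENNReal.ofReal (Q : Cube n).vol :=
    (tsum_subtype (Sel E p P) (fun Q => ENNReal.ofReal Q.vol)).symm
  rw [ww, this, ENNReal.tsum_toReal_eq (fun _ => ENNReal.ofReal_ne_top)]
  exact tsum_congr fun Q => ENNReal.toReal_ofReal Q.1.vol_pos_s15.le

variable {E}

theorem WW_mono {p q : ℝ → Prop} (P : Cube n) (h : ∀ l, 0 < l → l ≤ P.l → p l → q l) :
    WW E p P ≤ WW E q P := by
  refine ENNReal.tsum_le_tsum fun Q => ?_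
  refine Set.indicator_le_indicator_of_subset ?_ (fun _ => zero_le) Q
  rintro Q ⟨h1, h2⟩
  obtain ⟨j, hj⟩ := h1.1
  exact ⟨h1, h _ Q.l_pos hj.l_le h2⟩

theorem WW_zero {p : ℝ → Prop} (P : Cube n) (h : ∀ l, 0 < l → l ≤ P.l → ¬ p l) :
    WW E p P = 0 := by
  have : Sel E p P = ∅ := by
    rw [Set.eq_empty_iff_forall_notMem]
    rintro Q ⟨h1, h2⟩
    obtain ⟨j, hj⟩ := h1.1
    exact h _ Q.l_pos hj.l_le h2
  simp [WW, this]

theorem WW_disj {p : ℝ → Prop} {P : Cube n} (hP : P.carrier ∩ E = ∅) :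
    WW E p P = if p P.l then ENNReal.ofReal P.vol else 0 := by
  rw [WW, tsum_eq_single P]
  · simp [Set.indicator, Sel, DE_disj E hP]
  · intro Q hQ
    simp [Sel, DE_disj E hP, hQ]

theorem WW_meets {p : ℝ → Prop} {P : Cube n} (hP : (P.carrier ∩ E).Nonempty) :
    WW E p P = ∑ e, WW E p (P.child e) := by
  simp only [WW]
  rw [← Summable.tsum_finsetSum (fun _ _ => ENNReal.summable)]
  refine tsum_congr fun Q => ?_
  by_cases hQ : Q ∈ Sel E p P
  · obtain ⟨e, he⟩ := (DE_meets E hP Q).1 hQ.1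
    rw [Finset.sum_eq_single e]
    · rw [Set.indicator_of_mem hQ, Set.indicator_of_mem (show Q ∈ Sel E p (P.child e) from ⟨he, hQ.2⟩)]
    · intro e' _ hne
      refine Set.indicator_of_notMem ?_ _
      rintro ⟨h1, -⟩
      obtain ⟨j, hj⟩ := h1.1
      obtain ⟨i, hi⟩ := he.1
      exact hne (P.child_unique (hj.subset Q.corner_mem) (hi.subset Q.corner_mem))
    · simp
  · rw [Set.indicator_of_notMem hQ]
    symm
    refine Finset.sum_eq_zero fun e _ => Set.indicator_of_notMem ?_ _
    rintro ⟨h1, h2⟩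
    exact hQ ⟨(DE_meets E hP Q).2 ⟨e, h1⟩, h2⟩

theorem WW_le_of_trunc {p : ℝ → Prop} {P : Cube n} {B : ENNReal}
    (h : ∀ δ > 0, WW E (fun l => p l ∧ δ ≤ l) P ≤ B) : WW E p P ≤ B := by
  rw [WW, ENNReal.tsum_eq_iSup_sum]
  refine iSup_le fun T => ?_
  have : ∃ δ > 0, ∀ Q ∈ T, δ ≤ Q.l := by
    induction T using Finset.induction_on with
    | empty => exact ⟨1, one_pos, by simp⟩
    | insert Q T _ ih =>
      obtain ⟨δ, h0, h1⟩ := ih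
      refine ⟨min δ Q.l, lt_min h0 Q.l_pos, ?_⟩
      intro R hR
      rcases Finset.mem_insert.1 hR with rfl | hR
      · exact min_le_right _ _
      · exact (min_le_left _ _).trans (h1 R hR)
  obtain ⟨δ, h0, h1⟩ := this
  refine le_trans ?_ ((ENNReal.sum_le_tsum T).trans (h δ h0))
  refine Finset.sum_le_sum fun Q hQ => ?_
  by_cases hs : Q ∈ Sel E p P
  · rw [Set.indicator_of_mem hs, Set.indicator_of_mem]
    exact ⟨hs.1, hs.2, h1 Q hQ⟩
  · rw [Set.indicator_of_notMem hs]; exact zero_le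

theorem WW_add (p : ℝ → Prop) (P : Cube n) :
    WW E p P + WW E (fun l => ¬ p l) P = WW E (fun _ => True) P := by
  rw [WW, WW, WW, ← ENNReal.tsum_add]
  refine tsum_congr fun Q => ?_
  by_cases h1 : Q ∈ DE E P <;> by_cases h2 : p Q.l <;> simp [Set.indicator, Sel, h1, h2]

theorem sum_child_vol (P : Cube n) : ∑ e, ENNReal.ofReal (P.child e).vol = ENNReal.ofReal P.vol := by
  rw [← ENNReal.ofReal_sum_of_nonneg (fun e _ => (P.child e).vol_pos_s15.le)]
  congr 1
  rw [P.child_vol 0]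
  have : ∀ e, (P.child e).vol = (P.child 0).vol := fun e => rfl
  simp [this]

theorem exists_trunc (P : Cube n) {δ : ℝ} (hδ : 0 < δ) : ∃ m : ℕ, P.l / 2 ^ m < δ := by
  obtain ⟨m, hm⟩ := pow_unbounded_of_one_lt (P.l / δ) (one_lt_two)
  refine ⟨m, ?_⟩
  rw [div_lt_iff₀ hδ] at hm
  rw [div_lt_iff₀ (by positivity)]
  linarith

theorem child_trunc {P : Cube n} {δ : ℝ} {m : ℕ} (h : P.l / 2 ^ (m + 1) < δ) (e : Fin n → Fin 2) :
    (P.child e).l / 2 ^ m < δ := by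
  simp only [Cube.child]; rw [pow_succ] at h; rw [div_div, mul_comm]; exact h

theorem WW_le_vol (p : ℝ → Prop) (P : Cube n) : WW E p P ≤ ENNReal.ofReal P.vol := by
  refine WW_le_of_trunc fun δ hδ => ?_
  obtain ⟨m, hm⟩ := exists_trunc P hδ
  induction m generalizing P with
  | zero =>
    rw [WW_zero]
    · exact zero_le
    · rintro l - h2 ⟨-, h4⟩
      simp at hm
      linarith
  | succ m ih =>
    by_cases hP : (P.carrier ∩ E).Nonempty
    · rw [WW_meets hP, ← sum_child_vol]
      exact Finset.sum_le_sum fun e _ => ih _ (child_trunc hm e)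
    · rw [WW_disj (Set.not_nonempty_iff_eq_empty.1 hP)]
      split_ifs
      · exact le_rfl
      · exact zero_le

theorem WW_true (hE : IsClosed E) (hE0 : volume E = 0) (P : Cube n) :
    WW E (fun _ => True) P = ENNReal.ofReal P.vol := by
  refine le_antisymm (WW_le_vol _ _) ?_
  have hsub : P.carrier \ E ⊆ ⋃ Q ∈ DE E P, Q.carrier := by
    rintro x ⟨hx, hxE⟩
    obtain ⟨r, hr0, hr⟩ := Metric.isOpen_iff.1 hE.isOpen_compl x hxE
    obtain ⟨m, hm⟩ := exists_trunc P hr0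
    obtain ⟨Q, hQ, hxQ⟩ := DE_cover E (r := r) (fun y hy => by
      by_contra hlt
      exact hr (Metric.mem_ball.2 (not_le.1 hlt)) hy) hr0 m P hx hm
    simp only [Set.mem_iUnion]
    exact ⟨Q, hQ, hxQ⟩
  calc ENNReal.ofReal P.vol = volume P.carrier := P.volume_carrier_s15.symm
    _ = volume (P.carrier \ E) := (measure_sdiff_null hE0).symm
    _ ≤ volume (⋃ Q ∈ DE E P, Q.carrier) := measure_mono hsub
    _ ≤ ∑' Q : DE E P, volume (Q : Cube n).carrier := measure_biUnion_le _ (DE_countable_s15 E P) _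
    _ = ∑' Q : DE E P, ENNReal.ofReal (Q : Cube n).vol := by simp only [Cube.volume_carrier_s15]
    _ = ∑' Q, (DE E P).indicator (fun Q => ENNReal.ofReal Q.vol) Q :=
        tsum_subtype (DE E P) (fun Q => ENNReal.ofReal Q.vol)
    _ = WW E (fun _ => True) P := by simp [WW, Sel]

theorem WW_ne_top (p : ℝ → Prop) (P : Cube n) : WW E p P ≠ ⊤ :=
  ((WW_le_vol p P).trans_lt ENNReal.ofReal_lt_top).ne

theorem ww_mono {p q : ℝ → Prop} (P : Cube n) (h : ∀ l, 0 < l → l ≤ P.l → p l → q l) :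
    ww E p P ≤ ww E q P := ENNReal.toReal_mono (WW_ne_top _ _) (WW_mono P h)

theorem ww_zero {p : ℝ → Prop} (P : Cube n) (h : ∀ l, 0 < l → l ≤ P.l → ¬ p l) :
    ww E p P = 0 := by rw [ww, WW_zero P h]; rfl

theorem ww_nonneg (p : ℝ → Prop) (P : Cube n) : 0 ≤ ww E p P := ENNReal.toReal_nonneg

theorem ww_disj {p : ℝ → Prop} {P : Cube n} (hP : P.carrier ∩ E = ∅) :
    ww E p P = if p P.l then P.vol else 0 := by
  rw [ww, WW_disj hP]
  split_ifs
  · exact ENNReal.toReal_ofReal P.vol_pos_s15.le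
  · rfl

theorem ww_meets {p : ℝ → Prop} {P : Cube n} (hP : (P.carrier ∩ E).Nonempty) :
    ww E p P = ∑ e, ww E p (P.child e) := by
  rw [ww, WW_meets hP, ENNReal.toReal_sum (fun _ _ => WW_ne_top _ _)]; rfl

theorem ww_le_of_trunc {p : ℝ → Prop} {P : Cube n} {B : ℝ} (hB : 0 ≤ B)
    (h : ∀ δ > 0, ww E (fun l => p l ∧ δ ≤ l) P ≤ B) : ww E p P ≤ B := by
  refine ENNReal.toReal_le_of_le_ofReal hB (WW_le_of_trunc fun δ hδ => ?_)
  rw [ENNReal.le_ofReal_iff_toReal_le (WW_ne_top _ _) hB]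
  exact h δ hδ

theorem ww_true (hE : IsClosed E) (hE0 : volume E = 0) (P : Cube n) :
    ww E (fun _ => True) P = P.vol := by
  rw [ww, WW_true hE hE0, ENNReal.toReal_ofReal P.vol_pos_s15.le]

theorem ww_add (hE : IsClosed E) (hE0 : volume E = 0) (p : ℝ → Prop) (P : Cube n) :
    ww E p P + ww E (fun l => ¬ p l) P = P.vol := by
  rw [← ww_true hE hE0, ww, ww, ww, ← WW_add p P, ENNReal.toReal_add (WW_ne_top _ _) (WW_ne_top _ _)]

theorem core {s : ℝ} (hs : 0 < s) (hs2 : 2 ^ n * s < 1) (hs1 : s < 1) {p q : ℝ → Prop} {δ : ℝ}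
    (hp : ∀ l, p l → δ ≤ l)
    (H : ∀ P : Cube n, (P.carrier ∩ E).Nonempty → s * P.vol ≤ ww E p P →
      (1 - s) * P.vol ≤ ww E q P) (m : ℕ) :
    ∀ P : Cube n, P.l / 2 ^ m < δ → ww E p P < s * P.vol →
      (1 - s) / (2 ^ n * s) * ww E p P ≤ ww E q P := by
  induction m with
  | zero =>
    intro P hm _
    rw [ww_zero (p := p) P (fun l _ h2 h3 => by
      simp only [pow_zero, div_one] at hm; linarith [hp l h3])]
    simpa using ww_nonneg q P
  | succ m ih =>
    intro P hm hlt
    by_cases hP : (P.carrier ∩ E).Nonempty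
    · have hsum := ww_meets (p := p) hP
      rw [hsum, ww_meets (p := q) hP, Finset.mul_sum]
      refine Finset.sum_le_sum fun e _ => ?_
      by_cases hd : ww E p (P.child e) < s * (P.child e).vol
      · exact ih _ (child_trunc hm e) hd
      · have h1 : ww E p (P.child e) ≤ ww E p P := by
          rw [hsum]
          exact Finset.single_le_sum (f := fun e => ww E p (P.child e))
            (fun e _ => ww_nonneg _ _) (Finset.mem_univ e)
        have h2 := P.child_vol e
        have h3 := (P.child e).vol_pos_s15
        have h4 : ww E p (P.child e) < 2 ^ n * s * (P.child e).vol := by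
          rw [h2] at hlt; linarith
        push Not at hd
        by_cases hc : ((P.child e).carrier ∩ E).Nonempty
        · have h5 := H _ hc hd
          refine le_trans ?_ h5
          rw [div_mul_eq_mul_div, div_le_iff₀ (by positivity)]
          have := mul_le_mul_of_nonneg_left h4.le (sub_nonneg.2 hs1.le)
          linarith
        · rw [ww_disj (Set.not_nonempty_iff_eq_empty.1 hc)] at h4 hd
          split_ifs at h4 hd
          · nlinarith
          · nlinarith
    · rw [ww_disj (Set.not_nonempty_iff_eq_empty.1 hP)] at hlt ⊢
      have := P.vol_pos_s15
      split_ifs at hlt ⊢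
      · nlinarith
      · simpa using ww_nonneg q P

theorem step {s : ℝ} (hs : 0 < s) (hs2 : 2 ^ n * s < 1) (hs1 : s < 1) {p q : ℝ → Prop}
    (H : ∀ P : Cube n, (P.carrier ∩ E).Nonempty → s * P.vol ≤ ww E p P →
      (1 - s) * P.vol ≤ ww E q P) (P : Cube n) (hP : (P.carrier ∩ E).Nonempty) :
    (1 - s) * P.vol ≤ ww E q P ∨ (1 - s) / (2 ^ n * s) * ww E p P ≤ ww E q P := by
  by_cases hlt : s * P.vol ≤ ww E p P
  · exact Or.inl (H P hP hlt)
  push Not at hlt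
  right
  have hc : 0 < (1 - s) / (2 ^ n * s) := div_pos (by linarith) (by positivity)
  rw [mul_comm, ← le_div_iff₀ hc]
  refine ww_le_of_trunc (div_nonneg (ww_nonneg _ _) hc.le) fun δ hδ => ?_
  rw [le_div_iff₀ hc, mul_comm]
  obtain ⟨m, hm⟩ := exists_trunc P hδ
  refine core hs hs2 hs1 (fun l hl => hl.2) ?_ m P hm ?_
  · intro R hR h1
    exact H R hR (h1.trans (ww_mono R fun l _ _ hl => hl.1))
  · exact (ww_mono P fun l _ _ hl => hl.1).trans_lt hlt

/-- iteration of `step` along a sequence of predicates -/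
theorem iter {s t : ℝ} (hs : 0 < s) (hs2 : 2 ^ n * s < 1) (hs1 : s < 1)
    (hc : 1 ≤ (1 - s) / (2 ^ n * s)) {p : ℕ → ℝ → Prop}
    (H : ∀ k, ∀ P : Cube n, (P.carrier ∩ E).Nonempty → s * P.vol ≤ ww E (p k) P →
      (1 - s) * P.vol ≤ ww E (p (k + 1)) P) (P : Cube n) (hP : (P.carrier ∩ E).Nonempty)
    (h0 : t * P.vol ≤ ww E (p 0) P) (k : ℕ) :
    (1 - s) * P.vol ≤ ww E (p k) P ∨ ((1 - s) / (2 ^ n * s)) ^ k * t * P.vol ≤ ww E (p k) P := by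
  induction k with
  | zero => right; simpa using h0
  | succ k ih =>
    rcases step hs hs2 hs1 (H k) P hP with h1 | h1
    · exact Or.inl h1
    rcases ih with h2 | h2
    · left
      refine le_trans h2 (le_trans ?_ h1)
      exact le_mul_of_one_le_left (ww_nonneg _ _) hc
    · right
      refine le_trans ?_ h1
      rw [pow_succ]
      have := mul_le_mul_of_nonneg_left h2 (zero_le_one.trans hc)
      linarith

theorem sumGE_eq_s15 (P : Cube n) (L : ℝ) : sumGE E P L = ww E (fun l => L ≤ l) P := (ww_eq E _ P).symm

theorem sumLE_eq_s15 (P : Cube n) (L : ℝ) : sumLE E P L = ww E (fun l => l ≤ L) P :=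
  (ww_eq E (fun l => l ≤ L) P).symm

theorem Sfun_le {P : Cube n} {t L : ℝ} (hL : 0 ≤ L) (h : t * P.vol ≤ ww E (fun l => l ≤ L) P) :
    Sfun E P t ≤ L :=
  csInf_le ⟨0, fun _ hx => hx.1⟩ ⟨hL, by rwa [sumLE_eq_s15]⟩

theorem le_Lfun {P : Cube n} {t L : ℝ} (ht : 0 < t) (hL : 0 ≤ L)
    (h : t * P.vol ≤ ww E (fun l => L ≤ l) P) : L ≤ Lfun E P t := by
  refine le_csSup ⟨P.l, ?_⟩ ⟨hL, by rwa [sumGE_eq_s15]⟩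
  rintro x ⟨-, hx⟩
  by_contra hlt
  push Not at hlt
  rw [sumGE_eq_s15, ww_zero P (fun l _ h1 h2 => by linarith)] at hx
  have := mul_pos ht P.vol_pos_s15
  linarith

end dyadic

/-- From the single-parameter condition `𝓛_{Q₀}(s) ≤ C₀ 𝓢_{Q₀}(s)` for some
`0 < s < 1/(1+2ⁿ)`, one deduces the full comparison `𝓛_{Q₀}(t) ≤ (C̃₀/t^σ̃) 𝓢_{Q₀}(t)`
for all `t ∈ (0,1)`, for some constants `σ̃, C̃₀ > 0`. -/
theorem stmt15 {n : ℕ} (E : Set (Fin n → ℝ)) (hE : IsClosed E) (hne : E.Nonempty)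
    (hE0 : volume E = 0) (s C₀ : ℝ) (hC₀ : 0 < C₀)
    (hs : 0 < s) (hs' : s < 1 / (1 + 2 ^ n))
    (h : ∀ Q₀ : Cube n, (Q₀.carrier ∩ E).Nonempty → Lfun E Q₀ s ≤ C₀ * Sfun E Q₀ s) :
    ∃ σt Ct : ℝ, 0 < σt ∧ 0 < Ct ∧
      ∀ Q₀ : Cube n, (Q₀.carrier ∩ E).Nonempty → ∀ t ∈ Set.Ioo (0 : ℝ) 1,
        Lfun E Q₀ t ≤ Ct / t ^ σt * Sfun E Q₀ t := by
  have h2n : (1 : ℝ) ≤ 2 ^ n := one_le_pow₀ (by norm_num)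
  have hs3 : s * (1 + 2 ^ n) < 1 := by rwa [lt_div_iff₀ (by positivity)] at hs'
  have hs2 : 2 ^ n * s < 1 := by nlinarith
  have hs12 : 2 * s < 1 := by nlinarith
  have hs1 : s < 1 := by linarith
  have hc : 1 < (1 - s) / (2 ^ n * s) := by
    rw [lt_div_iff₀ (by positivity)]; linarith
  set c := (1 - s) / (2 ^ n * s) with hcdef
  obtain ⟨K, hK⟩ : ∃ K, K = 2 * C₀ + 1 := ⟨_, rfl⟩
  have hK1 : 1 < K := by linarith
  have hK0 : 0 < K := by linarith
  have hlogc : 0 < Real.log c := Real.log_pos hc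
  have hlogK : 0 < Real.log K := Real.log_pos hK1
  -- upward step for the small cubes
  have HS : ∀ L, 0 < L → ∀ P : Cube n, (P.carrier ∩ E).Nonempty →
      s * P.vol ≤ ww E (fun l => l ≤ L) P → (1 - s) * P.vol ≤ ww E (fun l => l ≤ K * L) P := by
    intro L hL P hP hp
    have h1 : Sfun E P s ≤ L := Sfun_le hL.le hp
    have h2 : Lfun E P s ≤ C₀ * L := (h P hP).trans (mul_le_mul_of_nonneg_left h1 hC₀.le)
    have h3 : ww E (fun l => K * L ≤ l) P < s * P.vol := by
      by_contra hcon
      push Not at hcon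
      have h4 := le_Lfun hs (by positivity) hcon
      nlinarith
    have h5 := ww_add hE hE0 (fun l => K * L ≤ l) P
    have h6 : ww E (fun l => ¬ K * L ≤ l) P ≤ ww E (fun l => l ≤ K * L) P :=
      ww_mono P fun l _ _ hl => (not_le.1 hl).le
    linarith
  have HL : ∀ L, 0 < L → ∀ P : Cube n, (P.carrier ∩ E).Nonempty →
      s * P.vol ≤ ww E (fun l => L ≤ l) P → (1 - s) * P.vol ≤ ww E (fun l => L / K ≤ l) P := by
    intro L hL P hP hp
    have h1 : L ≤ Lfun E P s := le_Lfun hs hL.le hp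
    have h2 : L ≤ C₀ * Sfun E P s := h1.trans (h P hP)
    have h3 : ww E (fun l => l ≤ L / K) P < s * P.vol := by
      by_contra hcon
      push Not at hcon
      have h4 := Sfun_le (by positivity) hcon
      rw [le_div_iff₀ hK0] at h4
      have h7 : 0 < Sfun E P s := by
        by_contra hn
        push Not at hn
        nlinarith
      nlinarith
    have h5 := ww_add hE hE0 (fun l => l ≤ L / K) P
    have h6 : ww E (fun l => ¬ l ≤ L / K) P ≤ ww E (fun l => L / K ≤ l) P :=
      ww_mono P fun l _ _ hl => (not_le.1 hl).le
    linarith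
  refine ⟨2 * Real.log K / Real.log c, K ^ 3, by positivity, by positivity, ?_⟩
  rintro P hP t ⟨ht0, ht1⟩
  set σ := 2 * Real.log K / Real.log c with hσ
  have hV := P.vol_pos_s15
  have hD : 0 < K ^ 3 / t ^ σ := div_pos (by positivity) (Real.rpow_pos_of_pos ht0 _)
  -- choice of the number of iterations
  obtain ⟨k, hk1, hk2⟩ : ∃ k : ℕ, 1 ≤ c ^ k * t ∧ K ^ (2 * k + 1) ≤ K ^ 3 / t ^ σ := by
    have hx : 0 ≤ -Real.log t / Real.log c :=
      div_nonneg (by linarith [Real.log_neg ht0 ht1]) hlogc.le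
    refine ⟨⌈-Real.log t / Real.log c⌉₊, ?_, ?_⟩
    · have h1 := Nat.le_ceil (-Real.log t / Real.log c)
      rw [div_le_iff₀ hlogc] at h1
      have hpos : 0 < c ^ ⌈-Real.log t / Real.log c⌉₊ := by positivity
      rw [← Real.log_nonneg_iff (by positivity), Real.log_mul hpos.ne' ht0.ne', Real.log_pow]
      linarith
    · have h1 := (Nat.ceil_lt_add_one hx).le
      rw [← Real.log_le_log_iff (by positivity) hD, Real.log_div (by positivity)
        (Real.rpow_pos_of_pos ht0 _).ne', Real.log_pow, Real.log_pow, Real.log_rpow ht0]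
      have h2 : σ * Real.log t = - (2 * (-Real.log t / Real.log c)) * Real.log K := by
        rw [hσ]; ring
      rw [h2]
      push_cast
      nlinarith
  have main : ∀ x ∈ Lset t P E, 0 < x → ∀ y ∈ Sset t P E, x ≤ K ^ 3 / t ^ σ * y := by
    rintro x ⟨-, hx⟩ hx0 y ⟨hy0, hy⟩
    rw [sumGE_eq_s15] at hx
    rw [sumLE_eq_s15] at hy
    have hypos : 0 < y := by
      by_contra hn
      rw [ww_zero P (fun l h1 _ h3 => by linarith)] at hy
      have := mul_pos ht0 hV
      linarith
    have hA := iter (p := fun k l => l ≤ K ^ k * y) (t := t) hs hs2 hs1 hc.le (fun k R hR hh => by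
      have := HS (K ^ k * y) (by positivity) R hR hh
      rwa [← mul_assoc, ← pow_succ'] at this) P hP (by simpa using hy) k
    have hB := iter (p := fun k l => x / K ^ k ≤ l) (t := t) hs hs2 hs1 hc.le (fun k R hR hh => by
      have := HL (x / K ^ k) (by positivity) R hR hh
      rwa [div_div, ← pow_succ] at this) P hP (by simpa using hx) k
    have hkv : s * P.vol ≤ c ^ k * t * P.vol := by nlinarith
    have hsv : s * P.vol ≤ (1 - s) * P.vol := by nlinarith
    have hA' : s * P.vol ≤ ww E (fun l => l ≤ K ^ k * y) P := by
      rcases hA with hA | hA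
      · exact hsv.trans hA
      · exact hkv.trans hA
    have hB' : s * P.vol ≤ ww E (fun l => x / K ^ k ≤ l) P := by
      rcases hB with hB | hB
      · exact hsv.trans hB
      · exact hkv.trans hB
    have h1 := le_Lfun hs (by positivity) hB'
    have h2 := Sfun_le (by positivity) hA'
    have h3 : x / K ^ k ≤ K * (K ^ k * y) := by
      have h4 := h P hP
      have h5 : C₀ * Sfun E P s ≤ C₀ * (K ^ k * y) := mul_le_mul_of_nonneg_left h2 hC₀.le
      have h6 : C₀ * (K ^ k * y) ≤ K * (K ^ k * y) :=
        mul_le_mul_of_nonneg_right (by linarith) (by positivity)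
      linarith
    rw [div_le_iff₀ (by positivity)] at h3
    have h4 : K * (K ^ k * y) * K ^ k = K ^ (2 * k + 1) * y := by ring
    rw [h4] at h3
    exact h3.trans (mul_le_mul_of_nonneg_right hk2 hypos.le)
  have hS0 : 0 ≤ Sfun E P t := Real.sInf_nonneg fun x hx => hx.1
  have htV : t * P.vol ≤ P.vol := by nlinarith
  refine csSup_le ⟨0, le_rfl, ?_⟩ fun x hx => ?_
  · rw [sumGE_eq_s15]
    refine htV.trans ?_
    rw [← ww_true hE hE0 P]
    exact ww_mono P fun l h1 _ _ => h1.le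
  rcases hx.1.eq_or_lt with h0 | h0
  · rw [← h0]; exact mul_nonneg hD.le hS0
  rw [mul_comm, ← div_le_iff₀ hD]
  refine le_csInf ⟨P.l, P.l_pos.le, ?_⟩ fun y hy => ?_
  · rw [sumLE_eq_s15]
    refine htV.trans ?_
    rw [← ww_true hE hE0 P]
    exact ww_mono P fun l _ h1 _ => h1
  · rw [div_le_iff₀ hD, mul_comm]
    exact main x hx h0 y hy
end
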